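/- arXiv:2206.09527 — 2 statements merged into one kernel-verified Lean document; each statement's English description precedes it below -/
import Mathlib

section
/- Let q ≥ 2 and K ≥ 2 be integers. There exists a ReQU network of architecture (1, B₂, B₃, …, B_q, K+q+2) with 4 + 2(q−2) hidden layers, all weights in [−1,1], and at most 72q(K+2q) nonzero weights, whose output at every x ∈ [0,1) equals the vector ( x, K, B_1^{q,K}(x), B_2^{q,K}(x), …, B_{q+K}^{q,K}(x) ); here B₂ denotes the block of hidden widths (4(K+2q−1)+K, 4K+8q, 4K+8q, 4K+8q) and, for m = 3, …, q, B_m denotes the block of hidden widths (12(K+2q−m)+12, 8(K+2q−m)+8). -/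
open scoped BigOperators Classical

noncomputable def requ (t : ℝ) : ℝ := (max t 0) ^ 2

structure ReQUNet where
  L : ℕ
  arch : ℕ → ℕ
  W : ℕ → ℕ → ℕ → ℝ
  v : ℕ → ℕ → ℝ

namespace ReQUNet

noncomputable def hidden (N : ReQUNet) (x : ℕ → ℝ) : ℕ → ℕ → ℝ
  | 0, j => ∑ k ∈ Finset.range (N.arch 0), N.W 0 j k * x k
  | i + 1, j =>
      ∑ k ∈ Finset.range (N.arch (i + 1)),
        N.W (i + 1) j k * requ (N.hidden x i k - N.v (i + 1) k)

noncomputable def eval (N : ReQUNet) (x : ℕ → ℝ) : ℕ → ℝ := N.hidden x N.L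

noncomputable def evalVec (N : ReQUNet) (d : ℕ) (x : Fin d → ℝ) : ℕ → ℝ :=
  N.eval fun k => if h : k < d then x ⟨k, h⟩ else 0

def width (N : ReQUNet) : ℕ := (Finset.range (N.L + 2)).sup N.arch

def weightsIn (N : ReQUNet) (s : Set ℝ) : Prop :=
  (∀ i ≤ N.L, ∀ j < N.arch (i + 1), ∀ k < N.arch i, N.W i j k ∈ s) ∧
  ∀ i, 1 ≤ i → i ≤ N.L → ∀ j < N.arch i, N.v i j ∈ s

noncomputable def numNonzero (N : ReQUNet) : ℕ :=
  (∑ i ∈ Finset.range (N.L + 1),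
    ((Finset.range (N.arch (i + 1)) ×ˢ Finset.range (N.arch i)).filter
      fun p => N.W i p.1 p.2 ≠ 0).card) +
  ∑ i ∈ Finset.Icc 1 N.L,
    ((Finset.range (N.arch i)).filter fun j => N.v i j ≠ 0).card

end ReQUNet

noncomputable def pderiv1 {d : ℕ} (i : Fin d) (g : (Fin d → ℝ) → ℝ) : (Fin d → ℝ) → ℝ :=
  fun x => fderiv ℝ g x (Pi.single i 1)

noncomputable def mderiv {d : ℕ} (γ : Fin d → ℕ) (g : (Fin d → ℝ) → ℝ) : (Fin d → ℝ) → ℝ :=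
  (List.finRange d).foldr (fun i h => (pderiv1 i)^[γ i] h) g

noncomputable def eucDist {d : ℕ} (x y : Fin d → ℝ) : ℝ :=
  Real.sqrt (∑ i, (x i - y i) ^ 2)

def cube (d : ℕ) : Set (Fin d → ℝ) := Set.Icc 0 1

def cubeHO (d : ℕ) : Set (Fin d → ℝ) := Set.Ico 0 1

def HolderNormLeOn {d : ℕ} (Ω : Set (Fin d → ℝ)) : ℕ → ((Fin d → ℝ) → ℝ) → ℝ → Prop
  | 0, g, E => ∀ x ∈ Ω, |g x| ≤ E
  | m + 1, g, E =>
      (∀ γ : Fin d → ℕ, (∑ i, γ i) ≤ m → ∀ x ∈ Ω, |mderiv γ g x| ≤ E) ∧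
      ∀ γ : Fin d → ℕ, (∑ i, γ i) = m → ∀ x ∈ Ω, ∀ y ∈ Ω, x ≠ y →
        |mderiv γ g x - mderiv γ g y| ≤ E * min 1 (eucDist x y)

def VHolderNormLe {d : ℕ} (p ℓ : ℕ) (f : (Fin d → ℝ) → Fin p → ℝ) (E : ℝ) : Prop :=
  ∀ i : Fin p, HolderNormLeOn (cube d) ℓ (fun x => f x i) E

noncomputable def lfloor (β : ℝ) : ℕ := ⌈β⌉₊ - 1

def MemHolderBall {d : ℕ} (p : ℕ) (β H : ℝ) (f : (Fin d → ℝ) → Fin p → ℝ) : Prop :=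
  (∀ i : Fin p, ContDiff ℝ (lfloor β : ℕ∞) fun x => f x i) ∧
  (∀ i : Fin p, ∀ γ : Fin d → ℕ, (∑ j, γ j) ≤ lfloor β →
      ∀ x ∈ cube d, |mderiv γ (fun y => f y i) x| ≤ H) ∧
  ∀ i : Fin p, ∀ γ : Fin d → ℕ, (∑ j, γ j) = lfloor β →
      ∀ x ∈ cube d, ∀ y ∈ cube d, x ≠ y →
        |mderiv γ (fun z => f z i) x - mderiv γ (fun z => f z i) y| ≤
          H * min 1 (eucDist x y) ^ (β - (lfloor β : ℝ))

def MemHolderBall1 {d : ℕ} (β H : ℝ) (f : (Fin d → ℝ) → ℝ) : Prop :=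
  (ContDiff ℝ (lfloor β : ℕ∞) f) ∧
  (∀ γ : Fin d → ℕ, (∑ j, γ j) ≤ lfloor β → ∀ x ∈ cube d, |mderiv γ f x| ≤ H) ∧
  ∀ γ : Fin d → ℕ, (∑ j, γ j) = lfloor β →
      ∀ x ∈ cube d, ∀ y ∈ cube d, x ≠ y →
        |mderiv γ f x - mderiv γ f y| ≤ H * min 1 (eucDist x y) ^ (β - (lfloor β : ℝ))

noncomputable def loglog2 (H : ℝ) : ℝ := if H ≤ 2 then 0 else Real.logb 2 (Real.logb 2 H)

noncomputable def knot (q K j : ℕ) : ℝ :=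
  if j ≤ q + 1 then 0 else if j ≤ q + K then ((j - (q + 1) : ℕ) : ℝ) / K else 1

noncomputable def Bspl (q K : ℕ) : ℕ → ℕ → ℝ → ℝ
  | 0, j, x =>
      if knot q K j < knot q K (j + 1) ∧ knot q K j ≤ x ∧ x < knot q K (j + 1) then
        1 / (knot q K (j + 1) - knot q K j)
      else 0
  | m + 1, j, x =>
      if knot q K j < knot q K (j + m + 2) ∧ knot q K j ≤ x ∧ x < knot q K (j + m + 2) then
        ((x - knot q K j) * Bspl q K m j x
            + (knot q K (j + m + 2) - x) * Bspl q K m (j + 1) x) /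
          (knot q K (j + m + 2) - knot q K j)
      else 0

noncomputable def Nspl (q K m j : ℕ) (x : ℝ) : ℝ :=
  (knot q K (j + m + 1) - knot q K j) * Bspl q K m j x

def QRanalytic {d : ℕ} (p : ℕ) (Q R : ℝ) (f : (Fin d → ℝ) → Fin p → ℝ) : Prop :=
  (∀ i : Fin p, ContDiff ℝ (⊤ : ℕ∞) fun x => f x i) ∧
  ∀ s : ℕ, VHolderNormLe p s f (Q * ((R : ℝ) ^ s)⁻¹ * (Nat.factorial s : ℝ))

def archSpec (q K i : ℕ) : ℕ :=
  if i = 0 then 1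
  else if i = 1 then 4 * (K + 2 * q - 1) + K
  else if i ≤ 4 then 4 * K + 8 * q
  else if i ≤ 4 + 2 * (q - 2) then
    (if (i - 5) % 2 = 0 then 12 * (K + 2 * q - (3 + (i - 5) / 2)) + 12
      else 8 * (K + 2 * q - (3 + (i - 5) / 2)) + 8)
  else K + q + 2

namespace SplineNet

section Splines

variable {q K : ℕ}

lemma knot_eq (hK : 0 < K) (j : ℕ) : knot q K j = ((min (j - (q + 1)) K : ℕ) : ℝ) / K := by
  have hK' : (K : ℝ) ≠ 0 := by positivity
  unfold knot
  split_ifs with h1 h2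
  · simp [Nat.sub_eq_zero_of_le h1]
  · rw [min_eq_left (by omega)]
  · rw [min_eq_right (by omega), div_self hK']

lemma knot_mono (hK : 0 < K) : Monotone (knot q K) := by
  intro i j h
  rw [knot_eq hK, knot_eq hK]
  have : min (i - (q + 1)) K ≤ min (j - (q + 1)) K := by omega
  gcongr

lemma knot_nonneg (hK : 0 < K) (j : ℕ) : 0 ≤ knot q K j := by
  rw [knot_eq hK]; positivity

lemma knot_le_one (hK : 0 < K) (j : ℕ) : knot q K j ≤ 1 := by
  have hK' : (0 : ℝ) < K := by positivity
  rw [knot_eq hK, div_le_one hK']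
  exact_mod_cast min_le_right _ _

lemma one_le_mul_knot_sub (hK : 0 < K) {i j : ℕ} (h : knot q K i < knot q K j) :
    1 ≤ (K : ℝ) * (knot q K j - knot q K i) := by
  have hK' : (0 : ℝ) < K := by positivity
  rw [knot_eq hK, knot_eq hK, div_lt_div_iff_of_pos_right hK'] at h
  rw [knot_eq hK, knot_eq hK, mul_sub, mul_div_cancel₀ _ hK'.ne', mul_div_cancel₀ _ hK'.ne']
  have h' := Nat.succ_le_of_lt (Nat.cast_lt.1 h)
  have : ((min (i - (q + 1)) K : ℕ) : ℝ) + 1 ≤ ((min (j - (q + 1)) K : ℕ) : ℝ) := by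
    exact_mod_cast h'
  linarith

lemma Bspl_eq_zero {m j : ℕ} {x : ℝ} (h : ¬ (knot q K j ≤ x ∧ x < knot q K (j + m + 1))) :
    Bspl q K m j x = 0 := by
  cases m with
  | zero => rw [Bspl, if_neg (fun h' => h h'.2)]
  | succ m => rw [Bspl, if_neg (fun h' => h h'.2)]

lemma Bspl_succ (hK : 0 < K) (m j : ℕ) (x : ℝ) :
    Bspl q K (m + 1) j x =
      ((x - knot q K j) * Bspl q K m j x
        + (knot q K (j + m + 2) - x) * Bspl q K m (j + 1) x) /
        (knot q K (j + m + 2) - knot q K j) := by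
  rw [Bspl]
  split_ifs with h
  · rfl
  · rcases eq_or_lt_of_le (knot_mono (q := q) hK (show j ≤ j + m + 2 by omega)) with he | hl
    · rw [he, sub_self, div_zero]
    · have h' : ¬ (knot q K j ≤ x ∧ x < knot q K (j + m + 2)) := fun h' => h ⟨hl, h'⟩
      have h1 : knot q K (j + m + 1) ≤ knot q K (j + m + 2) := knot_mono hK (by omega)
      have h2 : knot q K j ≤ knot q K (j + 1) := knot_mono hK (by omega)
      rw [Bspl_eq_zero (m := m) (j := j) (fun h'' => h' ⟨h''.1, h''.2.trans_le h1⟩),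
        Bspl_eq_zero (m := m) (j := j + 1) (fun h'' => h' ⟨h2.trans h''.1, by
          have := h''.2
          rwa [show j + 1 + m + 1 = j + m + 2 by ring] at this⟩)]
      simp

lemma Bspl_mem (hK : 0 < K) (m j : ℕ) (x : ℝ) : 0 ≤ Bspl q K m j x ∧ Bspl q K m j x ≤ K := by
  have hK' : (0 : ℝ) < K := by positivity
  induction m generalizing j with
  | zero =>
    rw [Bspl]
    split_ifs with h
    · have h1 := one_le_mul_knot_sub hK h.1
      have h0 : 0 < knot q K (j + 1) - knot q K j := by linarith [h.1]
      exact ⟨by positivity, by rw [div_le_iff₀ h0]; exact h1⟩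
    · exact ⟨le_rfl, hK'.le⟩
  | succ m ih =>
    rw [Bspl]
    split_ifs with h
    · have h0 : 0 < knot q K (j + m + 2) - knot q K j := by linarith [h.1]
      have ha : 0 ≤ x - knot q K j := by linarith [h.2.1]
      have hb : 0 ≤ knot q K (j + m + 2) - x := by linarith [h.2.2]
      obtain ⟨h1, h2⟩ := ih j
      obtain ⟨h3, h4⟩ := ih (j + 1)
      refine ⟨by positivity, ?_⟩
      rw [div_le_iff₀ h0]
      nlinarith [mul_le_mul_of_nonneg_left h2 ha, mul_le_mul_of_nonneg_left h4 hb]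
    · exact ⟨le_rfl, hK'.le⟩

lemma Bspl_zero_eq (hK : 0 < K) {x : ℝ} {k : ℕ} (hk : k < K) (h1 : (k : ℝ) ≤ K * x)
    (h2 : K * x < k + 1) (j : ℕ) :
    Bspl q K 0 j x = if j = q + 1 + k then (K : ℝ) else 0 := by
  have hK' : (0 : ℝ) < K := by positivity
  rw [Bspl, knot_eq hK, knot_eq hK]
  have e1 (a : ℕ) : (a : ℝ) / K ≤ x ↔ a ≤ k := by
    rw [div_le_iff₀ hK']
    constructor
    · intro h
      have : (a : ℝ) < k + 1 := by linarith
      exact_mod_cast Nat.lt_succ_iff.1 (by exact_mod_cast this)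
    · intro h
      have : (a : ℝ) ≤ k := by exact_mod_cast h
      linarith
  have e2 (a : ℕ) : x < (a : ℝ) / K ↔ k < a := by rw [← not_le, e1, not_le]
  simp only [e1, e2, div_lt_div_iff_of_pos_right hK', Nat.cast_lt]
  by_cases hj : j = q + 1 + k
  · subst hj
    rw [if_pos (by omega), if_pos rfl, min_eq_left (by omega), min_eq_left (by omega)]
    rw [show q + 1 + k - (q + 1) = k by omega, show q + 1 + k + 1 - (q + 1) = k + 1 by omega]
    push_cast
    field_simp
    ring
  · rw [if_neg hj, if_neg (by omega)]

/-- Second order B-splines on `[0, 1)` as combinations of the one-sided squares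
`requ (x - l / K)` and `requ (l / K - x)`. -/
noncomputable def quadSpline (q K j : ℕ) (x : ℝ) : ℝ :=
  if j + 1 = q then requ ((1 : ℕ) / K - x)
  else if j = q then 1 / 4 * requ ((2 : ℕ) / K - x) - requ ((1 : ℕ) / K - x)
  else if q < j ∧ j + 2 ≤ q + K then
    1 / 6 * requ ((j - q - 1 + 3 : ℕ) / K - x) - 1 / 2 * requ ((j - q - 1 + 2 : ℕ) / K - x)
      + 1 / 2 * requ ((j - q - 1 + 1 : ℕ) / K - x) - 1 / 6 * requ ((j - q - 1 : ℕ) / K - x)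
  else if j + 1 = q + K then
    1 / 4 * requ (x - (K - 2 : ℕ) / K) - requ (x - (K - 1 : ℕ) / K)
  else if j = q + K then requ (x - (K - 1 : ℕ) / K)
  else 0

lemma requ_right (hK : 0 < K) {x : ℝ} {k : ℕ} (h1 : (k : ℝ) ≤ K * x)
    (h2 : K * x < k + 1) (a : ℕ) :
    requ ((a : ℝ) / K - x) = if a ≤ k then 0 else ((a : ℝ) - K * x) ^ 2 / K ^ 2 := by
  have hK' : (0 : ℝ) < K := by positivity
  have e : (a : ℝ) / K - x = (a - K * x) / K := by field_simp
  unfold requ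
  rw [e]
  split_ifs with h
  · have : (a : ℝ) ≤ k := by exact_mod_cast h
    rw [max_eq_right (div_nonpos_of_nonpos_of_nonneg (by linarith) hK'.le)]; norm_num
  · have : (k : ℝ) + 1 ≤ a := by exact_mod_cast (by omega : k + 1 ≤ a)
    rw [max_eq_left (div_nonneg (by linarith) hK'.le), div_pow]

lemma requ_left (hK : 0 < K) {x : ℝ} {k : ℕ} (h1 : (k : ℝ) ≤ K * x)
    (h2 : K * x < k + 1) (a : ℕ) :
    requ (x - (a : ℝ) / K) = if a ≤ k then (K * x - (a : ℝ)) ^ 2 / K ^ 2 else 0 := by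
  have hK' : (0 : ℝ) < K := by positivity
  have e : x - (a : ℝ) / K = (K * x - a) / K := by field_simp
  unfold requ
  rw [e]
  split_ifs with h
  · have : (a : ℝ) ≤ k := by exact_mod_cast h
    rw [max_eq_left (div_nonneg (by linarith) hK'.le), div_pow]
  · have : (k : ℝ) + 1 ≤ a := by exact_mod_cast (by omega : k + 1 ≤ a)
    rw [max_eq_right (div_nonpos_of_nonpos_of_nonneg (by linarith) hK'.le)]; norm_num

lemma Bspl_two_eq (hK : 2 ≤ K) {x : ℝ} (hx0 : 0 ≤ x) (hx1 : x < 1) (j : ℕ) :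
    Bspl q K 2 j x = K ^ 3 * quadSpline q K j x := by
  have hK0 : 0 < K := by omega
  have hK' : (0 : ℝ) < K := by positivity
  obtain ⟨k, hk, h1, h2⟩ : ∃ k : ℕ, k < K ∧ (k : ℝ) ≤ K * x ∧ K * x < k + 1 := by
    refine ⟨⌊K * x⌋₊, ?_, Nat.floor_le (by positivity), Nat.lt_floor_add_one _⟩
    rw [Nat.floor_lt (by positivity)]
    nlinarith
  obtain ⟨t, rfl⟩ : ∃ t : ℝ, x = t / K := ⟨K * x, by field_simp⟩
  rw [mul_div_cancel₀ _ hK'.ne'] at h1 h2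
  have hR := requ_right hK0 (x := t / K) (k := k) (by rwa [mul_div_cancel₀ _ hK'.ne'])
    (by rwa [mul_div_cancel₀ _ hK'.ne'])
  have hL := requ_left hK0 (x := t / K) (k := k) (by rwa [mul_div_cancel₀ _ hK'.ne'])
    (by rwa [mul_div_cancel₀ _ hK'.ne'])
  have hB := Bspl_zero_eq (q := q) hK0 hk (x := t / K) (by rwa [mul_div_cancel₀ _ hK'.ne'])
    (by rwa [mul_div_cancel₀ _ hK'.ne'])
  have main : ∀ a b c d : ℕ, min (j - (q + 1)) K = a → min (j + 1 - (q + 1)) K = b →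
      min (j + 2 - (q + 1)) K = c → min (j + 3 - (q + 1)) K = d →
      Bspl q K 2 j (t / K) = K * (((t - a) * (((t - a) * (if j = q + 1 + k then 1 else 0)
          + (c - t) * (if j + 1 = q + 1 + k then 1 else 0)) / (c - a))
        + (d - t) * (((t - b) * (if j + 1 = q + 1 + k then 1 else 0)
          + (d - t) * (if j + 2 = q + 1 + k then 1 else 0)) / (d - b))) / (d - a)) := by
    intro a b c d ha hb hc hd
    rw [Bspl_succ hK0, Bspl_succ hK0, Bspl_succ hK0, hB, hB, hB]
    simp only [knot_eq hK0, add_zero, add_assoc, Nat.reduceAdd, ha, hb, hc, hd, ← sub_div]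
    have e (p r s : ℝ) : p / K * r / (s / K) = p * r / s := by field_simp
    have e3 (p1 r1 p2 r2 s : ℝ) :
        (p1 / K * r1 + p2 / K * r2) / (s / K) = (p1 * r1 + p2 * r2) / s := by
      field_simp
    have e4 (P : Prop) [Decidable P] : (if P then (K : ℝ) else 0) = K * (if P then 1 else 0) := by
      split_ifs <;> simp
    simp only [e3, e4]
    ring
  have eq3 (Y : ℝ) : (K : ℝ) ^ 3 * (Y / K ^ 2) = K * Y := by field_simp
  unfold quadSpline
  simp only [mul_div_cancel₀ _ hK'.ne'] at hR hL
  split_ifs with c1 c2 c3 c4 c5 <;> try simp only [hR, hL]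
  · rw [main 0 0 0 1 (by omega) (by omega) (by omega) (by omega)]
    split_ifs <;> first | omega | (push_cast; field_simp; ring)
  · rw [main 0 0 1 2 (by omega) (by omega) (by omega) (by omega)]
    split_ifs <;> first | omega | (push_cast; field_simp; ring)
  · obtain ⟨l, rfl⟩ : ∃ l, j = q + 1 + l := ⟨j - q - 1, by omega⟩
    rw [show q + 1 + l - q - 1 = l by omega,
      main l (l + 1) (l + 2) (l + 3) (by omega) (by omega) (by omega) (by omega)]
    push_cast
    rw [show (l : ℝ) + 2 - l = 2 by ring, show (l : ℝ) + 3 - (l + 1) = 2 by ring,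
      show (l : ℝ) + 3 - l = 3 by ring]
    split_ifs <;> first | omega | (field_simp; ring)
  · obtain ⟨n, rfl⟩ : ∃ n, K = n + 2 := ⟨K - 2, by omega⟩
    rw [main n (n + 1) (n + 2) (n + 2) (by omega) (by omega) (by omega) (by omega)]
    rw [show n + 2 - 2 = n by omega, show n + 2 - 1 = n + 1 by omega]
    push_cast at hK' ⊢
    rw [show (n : ℝ) + 2 - n = 2 by ring, show (n : ℝ) + 2 - (n + 1) = 1 by ring]
    split_ifs <;> first | omega | (field_simp; ring)
  · obtain ⟨n, rfl⟩ : ∃ n, K = n + 2 := ⟨K - 2, by omega⟩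
    rw [main (n + 1) (n + 2) (n + 2) (n + 2) (by omega) (by omega) (by omega) (by omega)]
    rw [show n + 2 - 1 = n + 1 by omega]
    push_cast at hK' ⊢
    rw [show (n : ℝ) + 2 - (n + 1) = 1 by ring]
    split_ifs <;> first | omega | (field_simp; ring)
  · rw [mul_zero]
    by_cases hj : j + 1 < q
    · rw [main 0 0 0 0 (by omega) (by omega) (by omega) (by omega)]
      simp
    · rw [main K K K K (by omega) (by omega) (by omega) (by omega)]
      simp

end Splines

section Forms

/-- The functional `c` times the `a`-th coordinate, as a coefficient sequence. -/
noncomputable def coord (a : ℕ) (c : ℝ) : ℕ → ℝ := fun k => if k = a then c else 0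

/-- The linear functional with coefficients `w` applied to the first `n` entries of `y`. -/
noncomputable def lin (n : ℕ) (w y : ℕ → ℝ) : ℝ := ∑ k ∈ Finset.range n, w k * y k

lemma lin_coord {n a : ℕ} (h : a < n) (c : ℝ) (y : ℕ → ℝ) : lin n (coord a c) y = c * y a := by
  simp [lin, coord, ite_mul, Finset.sum_ite_eq', h]

lemma lin_add (n : ℕ) (w w' y : ℕ → ℝ) : lin n (w + w') y = lin n w y + lin n w' y := by
  simp [lin, add_mul, Finset.sum_add_distrib]

lemma lin_sub (n : ℕ) (w w' y : ℕ → ℝ) : lin n (w - w') y = lin n w y - lin n w' y := by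
  simp [lin, sub_mul, Finset.sum_sub_distrib]

lemma lin_zero (n : ℕ) (y : ℕ → ℝ) : lin n 0 y = 0 := by simp [lin]

/-- At most `n` coefficients of `f` are nonzero. -/
def Sparse (n : ℕ) (f : ℕ → ℝ) : Prop := ∃ s : Finset ℕ, s.card ≤ n ∧ ∀ k, f k ≠ 0 → k ∈ s

lemma Sparse.mono {n m : ℕ} {f : ℕ → ℝ} (h : Sparse n f) (hnm : n ≤ m) : Sparse m f :=
  h.imp fun _ hs => ⟨hs.1.trans hnm, hs.2⟩

lemma Sparse.add {n m : ℕ} {f g : ℕ → ℝ} (hf : Sparse n f) (hg : Sparse m g) :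
    Sparse (n + m) (f + g) := by
  obtain ⟨s, hs, hs'⟩ := hf
  obtain ⟨t, ht, ht'⟩ := hg
  refine ⟨s ∪ t, (Finset.card_union_le _ _).trans (by omega), fun k hk => ?_⟩
  by_contra hn
  rw [Finset.mem_union, not_or] at hn
  exact hk (by simp [not_not.1 (mt (hs' k) hn.1), not_not.1 (mt (ht' k) hn.2)])

lemma Sparse.neg {n : ℕ} {f : ℕ → ℝ} (hf : Sparse n f) : Sparse n (-f) :=
  hf.imp fun _ hs => ⟨hs.1, fun k hk => hs.2 k (by simpa using hk)⟩

lemma Sparse.sub {n m : ℕ} {f g : ℕ → ℝ} (hf : Sparse n f) (hg : Sparse m g) :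
    Sparse (n + m) (f - g) := by
  rw [sub_eq_add_neg]; exact hf.add hg.neg

lemma sparse_zero (n : ℕ) : Sparse n 0 := ⟨∅, by simp, by simp⟩

lemma sparse_coord (a : ℕ) (c : ℝ) : Sparse 1 (coord a c) :=
  ⟨{a}, by simp, fun k hk => by
    by_contra h
    exact hk (if_neg (by simpa using h))⟩

lemma Sparse.card_filter_le {n : ℕ} {f : ℕ → ℝ} (hf : Sparse n f) (p : ℕ) :
    ((Finset.range p).filter fun k => f k ≠ 0).card ≤ n := by
  obtain ⟨s, hs, hs'⟩ := hf
  exact (Finset.card_le_card fun k hk => hs' k (Finset.mem_filter.1 hk).2).trans hs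

lemma abs_coord_le (a : ℕ) (c : ℝ) (k : ℕ) : |coord a c k| ≤ |c| := by
  unfold coord; split_ifs <;> simp

/-- A functional of the outputs of a layer of product gadgets, as a functional of its units: the
output of gadget `g` is a quarter of the difference of the units `2 g` and `2 g + 1`. -/
noncomputable def lift (w : ℕ → ℝ) : ℕ → ℝ :=
  fun k => if k % 2 = 0 then w (k / 2) / 4 else -(w (k / 2) / 4)

lemma lin_lift (G : ℕ) (w y : ℕ → ℝ) :
    lin (2 * G) (lift w) y = lin G w fun g => (y (2 * g) - y (2 * g + 1)) / 4 := by
  unfold lin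
  induction G with
  | zero => simp
  | succ G ih =>
    rw [show 2 * (G + 1) = 2 * G + 1 + 1 by ring, Finset.sum_range_succ, Finset.sum_range_succ,
      Finset.sum_range_succ, ih]
    have h1 : lift w (2 * G) = w G / 4 := by simp [lift]
    have h2 : lift w (2 * G + 1) = -(w G / 4) := by
      simp only [lift, if_neg (show ¬ (2 * G + 1) % 2 = 0 by omega)]
      rw [show (2 * G + 1) / 2 = G by omega]
    rw [h1, h2]; ring

lemma Sparse.lift {n : ℕ} {w : ℕ → ℝ} (h : Sparse n w) : Sparse (2 * n) (lift w) := by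
  obtain ⟨s, hs, hs'⟩ := h
  refine ⟨s.image (2 * ·) ∪ s.image (2 * · + 1), ?_, fun k hk => ?_⟩
  · refine (Finset.card_union_le _ _).trans ?_
    have h1 := Finset.card_image_le (s := s) (f := (2 * ·))
    have h2 := Finset.card_image_le (s := s) (f := (2 * · + 1))
    omega
  · have hw : w (k / 2) ≠ 0 := by
      intro h0
      exact hk (by simp [SplineNet.lift, h0])
    have := hs' _ hw
    rw [Finset.mem_union, Finset.mem_image, Finset.mem_image]
    rcases Nat.mod_two_eq_zero_or_one k with h | h
    · exact Or.inl ⟨k / 2, this, by omega⟩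
    · exact Or.inr ⟨k / 2, this, by omega⟩

lemma lift_zero : lift 0 = 0 := by
  funext k; simp [lift]

end Forms

/-- A layer of gadgets multiplying the affine forms `rU g + bU g` and `rV g + bV g` of the units
of the previous layer. -/
structure GadgetLayer where
  rU : ℕ → ℕ → ℝ
  rV : ℕ → ℕ → ℝ
  bU : ℕ → ℝ
  bV : ℕ → ℝ

namespace GadgetLayer

variable (D : GadgetLayer)

noncomputable def weight (j : ℕ) : ℕ → ℝ :=
  if j % 2 = 0 then D.rU (j / 2) + D.rV (j / 2) else D.rU (j / 2) - D.rV (j / 2)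

noncomputable def bias (j : ℕ) : ℝ :=
  if j % 2 = 0 then -(D.bU (j / 2) + D.bV (j / 2)) else -(D.bU (j / 2) - D.bV (j / 2))

lemma requ_sub_requ {u v : ℝ} (h : |v| ≤ u) : (requ (u + v) - requ (u - v)) / 4 = u * v := by
  rw [abs_le] at h
  unfold requ
  rw [max_eq_left (by linarith), max_eq_left (by linarith)]
  ring

lemma output_eq {p : ℕ} {y : ℕ → ℝ} {g : ℕ} {u v : ℝ} (hu : lin p (D.rU g) y + D.bU g = u)
    (hv : lin p (D.rV g) y + D.bV g = v) (h : |v| ≤ u) :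
    (requ (lin p (D.weight (2 * g)) y - D.bias (2 * g))
      - requ (lin p (D.weight (2 * g + 1)) y - D.bias (2 * g + 1))) / 4 = u * v := by
  have e0 : 2 * g % 2 = 0 := by omega
  have e1 : ¬ (2 * g + 1) % 2 = 0 := by omega
  have e2 : 2 * g / 2 = g := by omega
  have e3 : (2 * g + 1) / 2 = g := by omega
  rw [← requ_sub_requ h]
  simp only [weight, bias, if_pos e0, if_neg e1, e2, e3, lin_add, lin_sub]
  rw [← hu, ← hv]
  congr 3 <;> ring

/-- The gadgets with index at least `G` are unused. -/
def UnusedFrom (G : ℕ) : Prop :=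
  ∀ g, G ≤ g → D.rU g = 0 ∧ D.rV g = 0 ∧ D.bU g = 0 ∧ D.bV g = 0

variable {D}

lemma UnusedFrom.weight_eq {G : ℕ} (h : D.UnusedFrom G) {j : ℕ} (hj : 2 * G ≤ j) :
    D.weight j = 0 := by
  obtain ⟨h1, h2, -, -⟩ := h (j / 2) (by omega)
  simp [weight, h1, h2]

lemma UnusedFrom.bias_eq {G : ℕ} (h : D.UnusedFrom G) {j : ℕ} (hj : 2 * G ≤ j) :
    D.bias j = 0 := by
  obtain ⟨-, -, h1, h2⟩ := h (j / 2) (by omega)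
  simp [bias, h1, h2]

lemma sparse_weight {n m j : ℕ} (hU : Sparse n (D.rU (j / 2))) (hV : Sparse m (D.rV (j / 2))) :
    Sparse (n + m) (D.weight j) := by
  unfold weight
  split_ifs
  · exact hU.add hV
  · exact hU.sub hV

variable (D)

/-- All weights and biases lie in `[-1, 1]`. -/
def Bounded : Prop := (∀ j k, |D.weight j k| ≤ 1) ∧ ∀ j, |D.bias j| ≤ 1

variable {D}

lemma abs_bias_le (h : ∀ g, |D.bU g| + |D.bV g| ≤ 1) (j : ℕ) : |D.bias j| ≤ 1 := by
  unfold bias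
  split_ifs
  · rw [abs_neg]; exact (abs_add_le _ _).trans (h _)
  · rw [abs_neg]; exact (abs_sub _ _).trans (h _)

lemma abs_weight_le (h : ∀ g k, |D.rU g k| + |D.rV g k| ≤ 1) (j k : ℕ) :
    |D.weight j k| ≤ 1 := by
  unfold weight
  split_ifs
  · exact (abs_add_le _ _).trans (h _ _)
  · exact (abs_sub _ _).trans (h _ _)

/-- The gadget layer reading the affine forms `U g + bU g` and `V g + bV g` of the outputs of a
previous gadget layer. -/
noncomputable def ofForms (U V : ℕ → ℕ → ℝ) (bU bV : ℕ → ℝ) : GadgetLayer :=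
  ⟨fun g => lift (U g), fun g => lift (V g), bU, bV⟩

lemma bounded_ofForms {U V : ℕ → ℕ → ℝ} {bU bV : ℕ → ℝ}
    (h : ∀ g k, |U g k| + |V g k| ≤ 4) (hb : ∀ g, |bU g| + |bV g| ≤ 1) :
    (ofForms U V bU bV).Bounded := by
  refine ⟨abs_weight_le fun g k => ?_, abs_bias_le hb⟩
  have := h g (k / 2)
  simp only [ofForms, lift]
  split_ifs <;> simp only [abs_neg, abs_div, abs_of_pos (show (0 : ℝ) < 4 by norm_num)] <;> linarith

end GadgetLayer

lemma card_weights_le {W : ℕ → ℕ → ℝ} {n p U : ℕ} {c : ℕ → ℕ}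
    (h0 : ∀ j, U ≤ j → W j = 0) (hs : ∀ j, j < U → Sparse (c j) (W j)) :
    ((Finset.range n ×ˢ Finset.range p).filter fun z => W z.1 z.2 ≠ 0).card
      ≤ ∑ j ∈ Finset.range U, c j := by
  have hsub : ((Finset.range n ×ˢ Finset.range p).filter fun z => W z.1 z.2 ≠ 0) ⊆
      (Finset.range U).biUnion fun j =>
        ((Finset.range p).filter fun k => W j k ≠ 0).image fun k => (j, k) := by
    rintro ⟨j, k⟩ hz
    simp only [Finset.mem_filter, Finset.mem_product, Finset.mem_range] at hz
    simp only [Finset.mem_biUnion, Finset.mem_image, Finset.mem_filter, Finset.mem_range]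
    refine ⟨j, ?_, k, ⟨hz.1.2, hz.2⟩, rfl⟩
    by_contra hj
    exact hz.2 (by rw [h0 j (by omega)]; rfl)
  refine (Finset.card_le_card hsub).trans (Finset.card_biUnion_le.trans ?_)
  refine Finset.sum_le_sum fun j hj => Finset.card_image_le.trans ?_
  exact (hs j (Finset.mem_range.1 hj)).card_filter_le p

lemma card_bias_le {v : ℕ → ℝ} {n U : ℕ} (h0 : ∀ j, U ≤ j → v j = 0) :
    ((Finset.range n).filter fun j => v j ≠ 0).card ≤ U := by
  have : ((Finset.range n).filter fun j => v j ≠ 0) ⊆ Finset.range U := by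
    intro j hj
    rw [Finset.mem_range]
    by_contra h
    exact (Finset.mem_filter.1 hj).2 (h0 j (by omega))
  simpa using Finset.card_le_card this

namespace GadgetLayer

/-- The output of gadget `g`, when the units of the previous layer take the values `y`. -/
noncomputable def output (D : GadgetLayer) (p : ℕ) (y : ℕ → ℝ) (g : ℕ) : ℝ :=
  (requ (lin p (D.weight (2 * g)) y - D.bias (2 * g))
    - requ (lin p (D.weight (2 * g + 1)) y - D.bias (2 * g + 1))) / 4

lemma output_ofForms {U V : ℕ → ℕ → ℝ} {bU bV : ℕ → ℝ} {G : ℕ} {y : ℕ → ℝ} {g : ℕ} {u v : ℝ}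
    {z : ℕ → ℝ} (hz : z = fun g => (y (2 * g) - y (2 * g + 1)) / 4)
    (hu : lin G (U g) z + bU g = u) (hv : lin G (V g) z + bV g = v) (h : |v| ≤ u) :
    (ofForms U V bU bV).output (2 * G) y g = u * v := by
  subst hz
  exact output_eq _ (by rw [← hu, ← lin_lift]; rfl) (by rw [← hv, ← lin_lift]; rfl) h

end GadgetLayer

open GadgetLayer

section Layers

/-- A layer whose outputs `0, 1, 2` are `z 0`, `z 1`, `z 1 * z 0`, and whose output `3 + j` is the
product of the affine form `c + cb` with the linear form `f j`, for `j < n`. -/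
noncomputable def mulLayer (n : ℕ) (c : ℕ → ℝ) (cb : ℝ) (f : ℕ → ℕ → ℝ) : GadgetLayer :=
  ofForms
    (fun g => if g = 0 then 0 else if g < 3 then coord 1 1 else if g < 3 + n then c else 0)
    (fun g => if g = 1 then 0 else if g < 3 then coord 0 1 else if g < 3 + n then f (g - 3) else 0)
    (fun g => if g = 0 then 1 else if g < 3 then 0 else if g < 3 + n then cb else 0)
    (fun g => if g = 1 then 1 else 0)

lemma mulLayer_output {n G : ℕ} {c : ℕ → ℝ} {cb : ℝ} {f : ℕ → ℕ → ℝ} {y z b : ℕ → ℝ} {x κ a : ℝ}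
    (hz : z = fun g => (y (2 * g) - y (2 * g + 1)) / 4) (hG : 2 ≤ G)
    (h0 : z 0 = x) (h1 : z 1 = κ) (hx0 : 0 ≤ x) (hx1 : x ≤ 1) (hκ : 1 ≤ κ)
    (ha : lin G c z + cb = a) (hb : ∀ j < n, lin G (f j) z = b j) (hab : ∀ j < n, |b j| ≤ a) :
    (mulLayer n c cb f).output (2 * G) y 0 = x ∧ (mulLayer n c cb f).output (2 * G) y 1 = κ ∧
      (mulLayer n c cb f).output (2 * G) y 2 = κ * x ∧
      ∀ j < n, (mulLayer n c cb f).output (2 * G) y (3 + j) = a * b j := by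
  have hx : |x| ≤ 1 := by rwa [abs_of_nonneg hx0]
  have e0 : lin G (coord 0 1) z = x := by rw [lin_coord (by omega), h0, one_mul]
  have e1 : lin G (coord 1 1) z = κ := by rw [lin_coord (by omega), h1, one_mul]
  refine ⟨?_, ?_, ?_, fun j hj => ?_⟩
  · rw [← one_mul x]
    exact output_ofForms hz (by simp [lin_zero]) (by simp [e0]) hx
  · rw [← mul_one κ]
    exact output_ofForms hz (by simp [e1]) (by simp [lin_zero]) (by simpa using hκ)
  · exact output_ofForms hz (by simp [e1]) (by simp [e0]) (hx.trans hκ)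
  · exact output_ofForms hz
      (by simp only [if_neg (show ¬ 3 + j = 0 by omega), if_neg (show ¬ 3 + j < 3 by omega),
            if_pos (show 3 + j < 3 + n by omega), ha])
      (by simp only [if_neg (show ¬ 3 + j = 1 by omega), if_neg (show ¬ 3 + j < 3 by omega),
            if_pos (show 3 + j < 3 + n by omega), Nat.add_sub_cancel_left, hb j hj, add_zero])
      (hab j hj)

lemma mulLayer_bounded {n : ℕ} {c : ℕ → ℝ} {cb : ℝ} {f : ℕ → ℕ → ℝ}
    (h : ∀ j k, |c k| + |f j k| ≤ 4) (hb : |cb| ≤ 1) : (mulLayer n c cb f).Bounded := by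
  refine bounded_ofForms (fun g k => ?_) (fun g => ?_)
  · have h0 := abs_coord_le 0 1 k
    have h1 := abs_coord_le 1 1 k
    rw [abs_one] at h0 h1
    have := h (g - 3) k
    split_ifs <;> try simp only [Pi.zero_apply, abs_zero]
    all_goals linarith
  · split_ifs <;> simp_all

lemma mulLayer_unusedFrom (n : ℕ) (c : ℕ → ℝ) (cb : ℝ) (f : ℕ → ℕ → ℝ) :
    (mulLayer n c cb f).UnusedFrom (n + 3) := by
  intro g hg
  have h0 : ¬ g = 0 := by omega
  have h1 : ¬ g = 1 := by omega
  have h2 : ¬ g < 3 := by omega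
  have h3 : ¬ g < 3 + n := by omega
  simp [mulLayer, ofForms, h0, h1, h2, h3, lift_zero]

lemma mulLayer_sparse {n s t : ℕ} {c : ℕ → ℝ} {cb : ℝ} {f : ℕ → ℕ → ℝ} (hs : 1 ≤ s) (ht : 1 ≤ t)
    (hc : Sparse s c) (hf : ∀ j, Sparse t (f j)) (j : ℕ) :
    Sparse (2 * s + 2 * t) ((mulLayer n c cb f).weight j) := by
  refine sparse_weight (Sparse.lift ?_) (Sparse.lift ?_)
  · split_ifs
    exacts [sparse_zero _, (sparse_coord _ _).mono hs, hc, sparse_zero _]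
  · split_ifs
    exacts [sparse_zero _, (sparse_coord _ _).mono ht, hf _, sparse_zero _]

/-- A layer whose outputs `0, 1` are `z 0`, `z 1` and whose outputs `2 + 2 j`, `3 + 2 j` are
`(z 1 + z 2) * z (3 + j)`, `z 1 * z (3 + j)`, for `j < n`. -/
noncomputable def prodLayer (n : ℕ) : GadgetLayer :=
  ofForms
    (fun g => if g = 0 then 0 else if g < 2 + 2 * n then
      (if g % 2 = 0 then coord 1 1 + coord 2 1 else coord 1 1) else 0)
    (fun g => if g = 0 then coord 0 1 else if g = 1 then 0 else if g < 2 + 2 * n then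
      coord (3 + (g - 2) / 2) 1 else 0)
    (fun g => if g = 0 then 1 else 0)
    (fun g => if g = 1 then 1 else 0)

lemma prodLayer_output {n G : ℕ} {y z b : ℕ → ℝ} {x κ : ℝ}
    (hz : z = fun g => (y (2 * g) - y (2 * g + 1)) / 4) (hG : 3 + n ≤ G)
    (h0 : z 0 = x) (h1 : z 1 = κ) (h2 : z 2 = κ * x) (hx0 : 0 ≤ x) (hx1 : x ≤ 1) (hκ : 1 ≤ κ)
    (hb : ∀ j < n, z (3 + j) = b j) (hb1 : ∀ j < n, |b j| ≤ 1) :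
    (prodLayer n).output (2 * G) y 0 = x ∧ (prodLayer n).output (2 * G) y 1 = κ ∧
      ∀ j < n, (prodLayer n).output (2 * G) y (2 + 2 * j) = (κ + κ * x) * b j ∧
        (prodLayer n).output (2 * G) y (3 + 2 * j) = κ * b j := by
  have hx : |x| ≤ 1 := by rwa [abs_of_nonneg hx0]
  have hκx : 0 ≤ κ * x := by positivity
  have e0 : lin G (coord 0 1) z = x := by rw [lin_coord (by omega), h0, one_mul]
  have e1 : lin G (coord 1 1) z = κ := by rw [lin_coord (by omega), h1, one_mul]
  have e2 : lin G (coord 2 1) z = κ * x := by rw [lin_coord (by omega), h2, one_mul]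
  refine ⟨?_, ?_, fun j hj => ?_⟩
  · rw [← one_mul x]
    exact output_ofForms hz (by simp [lin_zero]) (by simp [e0]) hx
  · rw [← mul_one κ]
    exact output_ofForms hz
      (by simp only [one_ne_zero, if_false, if_pos (show 1 < 2 + 2 * n by omega),
            if_neg (show ¬ 1 % 2 = 0 by norm_num), e1, add_zero])
      (by simp [lin_zero]) (by simpa using hκ)
  have e3 : lin G (coord (3 + j) 1) z = b j := by
    rw [lin_coord (by omega), hb j hj, one_mul]
  constructor
  · refine output_ofForms hz ?_ ?_ ((hb1 j hj).trans (by linarith))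
    · simp only [if_neg (show ¬ 2 + 2 * j = 0 by omega),
        if_pos (show 2 + 2 * j < 2 + 2 * n by omega), if_pos (show (2 + 2 * j) % 2 = 0 by omega),
        lin_add, e1, e2, add_zero]
    · simp only [if_neg (show ¬ 2 + 2 * j = 0 by omega), if_neg (show ¬ 2 + 2 * j = 1 by omega),
        if_pos (show 2 + 2 * j < 2 + 2 * n by omega), show (2 + 2 * j - 2) / 2 = j by omega,
        e3, add_zero]
  · refine output_ofForms hz ?_ ?_ ((hb1 j hj).trans hκ)
    · simp only [if_neg (show ¬ 3 + 2 * j = 0 by omega),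
        if_pos (show 3 + 2 * j < 2 + 2 * n by omega), if_neg (show ¬ (3 + 2 * j) % 2 = 0 by omega),
        e1, add_zero]
    · simp only [if_neg (show ¬ 3 + 2 * j = 0 by omega), if_neg (show ¬ 3 + 2 * j = 1 by omega),
        if_pos (show 3 + 2 * j < 2 + 2 * n by omega), show (3 + 2 * j - 2) / 2 = j by omega,
        e3, add_zero]

lemma prodLayer_bounded (n : ℕ) : (prodLayer n).Bounded := by
  refine bounded_ofForms (fun g k => ?_) (fun g => ?_)
  · have h0 := abs_coord_le 0 1 k
    have h1 := abs_coord_le 1 1 k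
    have h2 := abs_coord_le 2 1 k
    have h3 := abs_coord_le (3 + (g - 2) / 2) 1 k
    have h4 := abs_add_le (coord 1 1 k) (coord 2 1 k)
    rw [abs_one] at h0 h1 h2 h3
    split_ifs <;> try simp only [Pi.zero_apply, abs_zero, Pi.add_apply]
    all_goals linarith
  · split_ifs <;> simp_all

lemma prodLayer_unusedFrom (n : ℕ) : (prodLayer n).UnusedFrom (2 + 2 * n) := by
  intro g hg
  have h0 : ¬ g = 0 := by omega
  have h1 : ¬ g = 1 := by omega
  have h3 : ¬ g < 2 + 2 * n := by omega
  simp [prodLayer, ofForms, h0, h1, h3, lift_zero]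

lemma prodLayer_sparse (n j : ℕ) : Sparse 6 ((prodLayer n).weight j) := by
  refine sparse_weight (n := 2 * 2) (m := 2 * 1) (Sparse.lift ?_) (Sparse.lift ?_)
  · split_ifs
    exacts [sparse_zero _, (sparse_coord _ _).add (sparse_coord _ _),
      (sparse_coord _ _).mono (by norm_num), sparse_zero _]
  · split_ifs
    exacts [sparse_coord _ _, sparse_zero _, sparse_coord _ _, sparse_zero _]

/-- The Cox-de Boor recursion for the `(j + 1)`-st B-spline of order `m` divided by `K`, as a
linear form in the outputs of `prodLayer`. -/
noncomputable def recForm (q K m j : ℕ) : ℕ → ℝ :=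
  let h := (K : ℝ) * (knot q K (j + 1 + m + 1) - knot q K (j + 1))
  coord (2 + 2 * j) (1 / h) - coord (3 + 2 * j) ((1 + knot q K (j + 1)) / h)
    + coord (5 + 2 * j) ((1 + knot q K (j + 1 + m + 1)) / h) - coord (4 + 2 * j) (1 / h)

lemma recForm_sparse (q K m j : ℕ) : Sparse 4 (recForm q K m j) :=
  (((sparse_coord _ _).sub (sparse_coord _ _)).add (sparse_coord _ _)).sub (sparse_coord _ _)

lemma abs_recForm_le {q K : ℕ} (hK : 0 < K) (m j k : ℕ) : |recForm q K m j k| ≤ 2 := by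
  have ha := knot_nonneg (q := q) hK (j + 1)
  have ha' := knot_le_one (q := q) hK (j + 1)
  have hb := knot_nonneg (q := q) hK (j + 1 + m + 1)
  have hb' := knot_le_one (q := q) hK (j + 1 + m + 1)
  have key : ∀ t : ℝ, 0 ≤ t → t ≤ 2 →
      |t / ((K : ℝ) * (knot q K (j + 1 + m + 1) - knot q K (j + 1)))| ≤ 2 := by
    intro t ht0 ht
    rcases eq_or_lt_of_le (knot_mono (q := q) hK (show j + 1 ≤ j + 1 + m + 1 by omega)) with he | hl
    · rw [he, sub_self, mul_zero, div_zero, abs_zero]; norm_num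
    · have h1 := one_le_mul_knot_sub hK hl
      rw [abs_of_nonneg (by positivity), div_le_iff₀ (by linarith)]
      linarith
  have k1 := key 1 (by norm_num) (by norm_num)
  have k2 := key (1 + knot q K (j + 1)) (by linarith) (by linarith)
  have k3 := key (1 + knot q K (j + 1 + m + 1)) (by linarith) (by linarith)
  simp only [recForm, coord, Pi.add_apply, Pi.sub_apply]
  split_ifs <;> first
    | (exfalso; omega)
    | (simp; done)
    | simpa using k1
    | simpa using k2
    | simpa using k3

lemma lin_recForm {q K m j G : ℕ} {z : ℕ → ℝ} {x : ℝ} (hK : 0 < K) (hG : 6 + 2 * j ≤ G)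
    (h0 : z (2 + 2 * j) = (K + K * x) * (Bspl q K m (j + 1) x / K))
    (h1 : z (3 + 2 * j) = K * (Bspl q K m (j + 1) x / K))
    (h2 : z (4 + 2 * j) = (K + K * x) * (Bspl q K m (j + 2) x / K))
    (h3 : z (5 + 2 * j) = K * (Bspl q K m (j + 2) x / K)) :
    lin G (recForm q K (m + 1) j) z = Bspl q K (m + 1) (j + 1) x / K := by
  have hK' : (K : ℝ) ≠ 0 := by positivity
  rw [recForm, lin_sub, lin_add, lin_sub, lin_coord (by omega), lin_coord (by omega),
    lin_coord (by omega), lin_coord (by omega), h0, h1, h2, h3, Bspl_succ hK,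
    show j + 1 + (m + 1) + 1 = j + 1 + m + 2 by ring, show j + 1 + 1 = j + 2 by ring]
  set a := knot q K (j + 1)
  set a' := knot q K (j + 1 + m + 2)
  by_cases h : a' - a = 0
  · simp [h]
  · field_simp
    ring

/-- Together with `scaleBias`, the affine form that is `K` at the last order `m = q` and `1` at the
lower orders; it scales the B-splines divided by `K`. -/
noncomputable def scaleForm (q m : ℕ) : ℕ → ℝ := if m = q then coord 1 1 else 0

noncomputable def scaleBias (q m : ℕ) : ℝ := if m = q then 0 else 1

lemma scaleForm_sparse (q m : ℕ) : Sparse 1 (scaleForm q m) := by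
  unfold scaleForm
  split_ifs
  exacts [sparse_coord _ _, sparse_zero _]

lemma abs_scaleBias_le (q m : ℕ) : |scaleBias q m| ≤ 1 := by
  unfold scaleBias; split_ifs <;> simp

lemma abs_scaleForm_le (q m k : ℕ) : |scaleForm q m k| ≤ 1 := by
  unfold scaleForm
  split_ifs
  · simpa using abs_coord_le 1 1 k
  · simp

lemma lin_scale {q m G : ℕ} {z : ℕ → ℝ} {κ : ℝ} (hG : 2 ≤ G) (h1 : z 1 = κ) :
    lin G (scaleForm q m) z + scaleBias q m = if m = q then κ else 1 := by
  unfold scaleForm scaleBias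
  split_ifs
  · rw [lin_coord (by omega), h1]; ring
  · rw [lin_zero]; ring

end Layers

section FirstLayers

/-- The weights of the first hidden layer: its units are `(x + 1) ^ 2`, `(1 - x) ^ 2`, `K` times the
constant `1`, and the one-sided squares of `x - k / K` and `k / K - x`. -/
noncomputable def inputWeight (K j : ℕ) : ℝ :=
  if j = 0 then 1 else if j < 2 then -1 else if j < K + 2 then 0
  else if j < 2 * K + 2 then 1 else if j < 3 * K + 3 then -1 else 0

noncomputable def inputBias (K j : ℕ) : ℝ :=
  if j < K + 2 then -1 else if j < 2 * K + 2 then (j - (K + 2) : ℕ) / K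
  else if j < 3 * K + 3 then -((j - (2 * K + 2) : ℕ) / K) else 0

lemma abs_inputWeight_le (K j : ℕ) : |inputWeight K j| ≤ 1 := by
  unfold inputWeight; split_ifs <;> simp

lemma abs_inputBias_le {K : ℕ} (hK : 0 < K) (j : ℕ) : |inputBias K j| ≤ 1 := by
  have hK' : (0 : ℝ) < K := by positivity
  have key : ∀ a : ℕ, a ≤ K → |(a : ℝ) / K| ≤ 1 := fun a ha => by
    rw [abs_of_nonneg (by positivity), div_le_one hK']
    exact_mod_cast ha
  unfold inputBias
  split_ifs
  · simp
  · exact key _ (by omega)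
  · rw [abs_neg]; exact key _ (by omega)
  · simp

/-- The unit `k` of the first hidden layer on the input `x`. -/
noncomputable def inputUnit (K : ℕ) (x : ℝ) (k : ℕ) : ℝ :=
  requ (inputWeight K k * x - inputBias K k)

lemma inputUnit_zero (K : ℕ) (x : ℝ) : inputUnit K x 0 = requ (1 + x) := by
  simp [inputUnit, inputWeight, inputBias, add_comm]

lemma inputUnit_one (K : ℕ) (x : ℝ) : inputUnit K x 1 = requ (1 - x) := by
  simp only [inputUnit, inputWeight, inputBias, one_ne_zero, if_false, if_pos Nat.one_lt_two,
    if_pos (show 1 < K + 2 by omega)]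
  congr 1; ring

lemma inputUnit_const {K k : ℕ} (h2 : 2 ≤ k) (hk : k < K + 2) (x : ℝ) : inputUnit K x k = 1 := by
  simp [inputUnit, inputWeight, inputBias, requ, show k ≠ 0 by omega, show ¬ k < 2 by omega, hk]

lemma inputUnit_left {K k : ℕ} (hk : k < K) (x : ℝ) :
    inputUnit K x (K + 2 + k) = requ (x - (k : ℝ) / K) := by
  simp only [inputUnit, inputWeight, inputBias, if_neg (show ¬ K + 2 + k = 0 by omega),
    if_neg (show ¬ K + 2 + k < 2 by omega), if_neg (show ¬ K + 2 + k < K + 2 by omega),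
    if_pos (show K + 2 + k < 2 * K + 2 by omega), Nat.add_sub_cancel_left, one_mul]

lemma inputUnit_right {K k : ℕ} (hk : k ≤ K) (x : ℝ) :
    inputUnit K x (2 * K + 2 + k) = requ ((k : ℝ) / K - x) := by
  simp only [inputUnit, inputWeight, inputBias, if_neg (show ¬ 2 * K + 2 + k = 0 by omega),
    if_neg (show ¬ 2 * K + 2 + k < 2 by omega), if_neg (show ¬ 2 * K + 2 + k < K + 2 by omega),
    if_neg (show ¬ 2 * K + 2 + k < 2 * K + 2 by omega),
    if_pos (show 2 * K + 2 + k < 3 * K + 3 by omega), Nat.add_sub_cancel_left]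
  congr 1; ring

/-- The sum of the constant units of the first hidden layer, times `c`. -/
noncomputable def constForm (K : ℕ) (c : ℝ) : ℕ → ℝ := fun k => if 2 ≤ k ∧ k < K + 2 then c else 0

lemma constForm_sparse (K : ℕ) (c : ℝ) : Sparse K (constForm K c) :=
  ⟨Finset.Ico 2 (K + 2), by simp, fun k hk => by
    by_contra h
    exact hk (if_neg (by simpa using h))⟩

lemma abs_constForm_le (K : ℕ) (c : ℝ) (k : ℕ) : |constForm K c k| ≤ |c| := by
  unfold constForm; split_ifs <;> simp

lemma lin_constForm {K p : ℕ} (hp : K + 2 ≤ p) (c x : ℝ) :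
    lin p (constForm K c) (inputUnit K x) = K * c := by
  have : ∀ k ∈ Finset.range p, constForm K c k * inputUnit K x k =
      if k ∈ Finset.Ico 2 (K + 2) then c else 0 := by
    intro k _
    by_cases h : 2 ≤ k ∧ k < K + 2
    · simp [constForm, h, inputUnit_const h.1 h.2]
    · simp [constForm, h]
  rw [lin, Finset.sum_congr rfl this, ← Finset.sum_filter, Finset.filter_mem_eq_inter,
    Finset.inter_eq_right.2 fun k hk => by
      rw [Finset.mem_Ico] at hk; rw [Finset.mem_range]; omega]
  simp

/-- `quadSpline q K j` as a linear form in the units of the first hidden layer. -/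
noncomputable def quadForm (q K j : ℕ) : ℕ → ℝ :=
  if j + 1 = q then coord (2 * K + 2 + 1) 1
  else if j = q then coord (2 * K + 2 + 2) (1 / 4) - coord (2 * K + 2 + 1) 1
  else if q < j ∧ j + 2 ≤ q + K then
    coord (2 * K + 2 + (j - q - 1 + 3)) (1 / 6) - coord (2 * K + 2 + (j - q - 1 + 2)) (1 / 2)
      + coord (2 * K + 2 + (j - q - 1 + 1)) (1 / 2) - coord (2 * K + 2 + (j - q - 1)) (1 / 6)
  else if j + 1 = q + K then coord (K + 2 + (K - 2)) (1 / 4) - coord (K + 2 + (K - 1)) 1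
  else if j = q + K then coord (K + 2 + (K - 1)) 1
  else 0

lemma lin_quadForm {q K p : ℕ} (hK : 2 ≤ K) (hp : 3 * K + 3 ≤ p) (j : ℕ) (x : ℝ) :
    lin p (quadForm q K j) (inputUnit K x) = quadSpline q K j x := by
  unfold quadForm quadSpline
  split_ifs
  · rw [lin_coord (by omega), inputUnit_right (by omega), one_mul]
  · rw [lin_sub, lin_coord (by omega), lin_coord (by omega), inputUnit_right (by omega),
      inputUnit_right (by omega), one_mul]
  · rw [lin_sub, lin_add, lin_sub, lin_coord (by omega), lin_coord (by omega),
      lin_coord (by omega), lin_coord (by omega), inputUnit_right (by omega),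
      inputUnit_right (by omega), inputUnit_right (by omega), inputUnit_right (by omega)]
  · rw [lin_sub, lin_coord (by omega), lin_coord (by omega), inputUnit_left (by omega),
      inputUnit_left (by omega), one_mul]
  · rw [lin_coord (by omega), inputUnit_left (by omega), one_mul]
  · rw [lin_zero]

lemma quadForm_sparse (q K j : ℕ) : Sparse 4 (quadForm q K j) := by
  have h1 (a : ℕ) (c : ℝ) := sparse_coord a c
  unfold quadForm
  split_ifs
  · exact (h1 _ _).mono (by norm_num)
  · exact ((h1 _ _).sub (h1 _ _)).mono (by norm_num)
  · exact (((h1 _ _).sub (h1 _ _)).add (h1 _ _)).sub (h1 _ _)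
  · exact ((h1 _ _).sub (h1 _ _)).mono (by norm_num)
  · exact (h1 _ _).mono (by norm_num)
  · exact sparse_zero _

lemma abs_quadForm_le {q K : ℕ} (hK : 2 ≤ K) (j k : ℕ) : |quadForm q K j k| ≤ 1 := by
  unfold quadForm
  split_ifs <;> simp only [Pi.add_apply, Pi.sub_apply, Pi.zero_apply, coord] <;> try split_ifs
  all_goals
    first
      | (exfalso; omega)
      | (rw [abs_le]; norm_num)

/-- The second hidden layer, whose outputs are `x`, `K`, `K ^ 2 / 4` and the first `n` functions
`quadSpline q K (j + 1)`. -/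
noncomputable def firstLayer (q K n : ℕ) : GadgetLayer where
  rU g := if g = 0 then 0 else if g = 1 then constForm K 1 else if g = 2 then constForm K (1 / 2)
    else 0
  rV g := if g = 0 then coord 0 (1 / 4) - coord 1 (1 / 4) else if g = 1 then 0
    else if g = 2 then constForm K (1 / 2) else if g < 3 + n then quadForm q K (g - 3 + 1) else 0
  bU g := if g = 0 then 1 else if g < 3 then 0 else if g < 3 + n then 1 else 0
  bV g := if g = 1 then 1 else 0

lemma firstLayer_unusedFrom (q K n : ℕ) : (firstLayer q K n).UnusedFrom (n + 3) := by
  intro g hg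
  have h0 : ¬ g = 0 := by omega
  have h1 : ¬ g = 1 := by omega
  have h2 : ¬ g = 2 := by omega
  have h3 : ¬ g < 3 := by omega
  have h4 : ¬ g < 3 + n := by omega
  simp [firstLayer, h0, h1, h2, h3, h4]

lemma firstLayer_bounded {q K : ℕ} (hK : 2 ≤ K) (n : ℕ) : (firstLayer q K n).Bounded := by
  refine ⟨abs_weight_le fun g k => ?_, abs_bias_le fun g => ?_⟩
  · have h0 := abs_sub (coord 0 (1 / 4) k) (coord 1 (1 / 4) k)
    have h1 := abs_coord_le 0 (1 / 4) k
    have h2 := abs_coord_le 1 (1 / 4) k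
    have h3 := abs_constForm_le K 1 k
    have h4 := abs_constForm_le K (1 / 2) k
    have h5 := abs_quadForm_le (q := q) hK (g - 3 + 1) k
    rw [abs_of_nonneg (show (0 : ℝ) ≤ 1 / 4 by norm_num)] at h1 h2
    rw [abs_one] at h3
    rw [abs_of_nonneg (show (0 : ℝ) ≤ 1 / 2 by norm_num)] at h4
    simp only [firstLayer]
    split_ifs <;> try simp only [Pi.zero_apply, abs_zero, Pi.sub_apply]
    all_goals linarith
  · simp only [firstLayer]
    split_ifs <;> simp_all

lemma firstLayer_sparse {q K : ℕ} (n j : ℕ) :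
    Sparse (if j / 2 = 1 ∨ j / 2 = 2 then 2 * K else 4) ((firstLayer q K n).weight j) := by
  split_ifs with h
  · rw [two_mul]
    refine sparse_weight ?_ ?_
    · rcases h with h | h <;> simp [firstLayer, h, constForm_sparse]
    · rcases h with h | h <;> simp [firstLayer, h, constForm_sparse, sparse_zero]
  · rw [not_or] at h
    refine sparse_weight (n := 0) (m := 4) ?_ ?_
    · simp [firstLayer, h, sparse_zero]
    · simp only [firstLayer, if_neg h.1, if_neg h.2]
      split_ifs
      exacts [((sparse_coord _ _).sub (sparse_coord _ _)).mono (by norm_num), quadForm_sparse _ _ _,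
        sparse_zero _]

lemma firstLayer_output {q K n p : ℕ} {x : ℝ} (hK : 2 ≤ K) (hp : 3 * K + 3 ≤ p)
    (hx0 : 0 ≤ x) (hx1 : x < 1) :
    (firstLayer q K n).output p (inputUnit K x) 0 = x ∧
      (firstLayer q K n).output p (inputUnit K x) 1 = K ∧
      (firstLayer q K n).output p (inputUnit K x) 2 = (K : ℝ) ^ 2 / 4 ∧
      ∀ j < n, (firstLayer q K n).output p (inputUnit K x) (3 + j)
        = Bspl q K 2 (j + 1) x / K ^ 3 := by
  have hK2 : (2 : ℝ) ≤ K := by exact_mod_cast hK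
  refine ⟨?_, ?_, ?_, fun j hj => ?_⟩
  · rw [← one_mul x]
    refine output_eq _ (by simp [firstLayer, lin_zero]) ?_ (by rw [abs_of_nonneg hx0]; exact hx1.le)
    simp only [firstLayer, if_true, if_neg zero_ne_one, one_mul]
    rw [lin_sub, lin_coord (by omega), lin_coord (by omega), inputUnit_zero, inputUnit_one]
    unfold requ
    rw [max_eq_left (by linarith), max_eq_left (by linarith)]
    ring
  · rw [← mul_one (K : ℝ)]
    refine output_eq _ ?_ (by simp [firstLayer, lin_zero]) (by rw [abs_one]; linarith)
    simp [firstLayer, lin_constForm (show K + 2 ≤ p by omega)]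
  · rw [show (K : ℝ) ^ 2 / 4 = (K * (1 / 2)) * (K * (1 / 2)) by ring]
    refine output_eq _ ?_ ?_ (abs_of_nonneg (by positivity)).le
    · simp [firstLayer, lin_constForm (show K + 2 ≤ p by omega)]
    · simp [firstLayer, lin_constForm (show K + 2 ≤ p by omega)]
  · rw [← one_mul (_ / _)]
    refine output_eq _ ?_ ?_ ?_
    · simp [firstLayer, show ¬ 3 + j = 1 by omega, show ¬ 3 + j = 2 by omega, lin_zero, hj]
    · simp only [firstLayer, if_neg (show ¬ 3 + j = 0 by omega), if_neg (show ¬ 3 + j = 1 by omega),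
        if_neg (show ¬ 3 + j = 2 by omega), if_pos (show 3 + j < 3 + n by omega),
        Nat.add_sub_cancel_left, lin_quadForm hK hp, Bspl_two_eq hK hx0 hx1]
      field_simp
      ring
    · obtain ⟨h0, h1⟩ := Bspl_mem (q := q) (K := K) (by omega) 2 (j + 1) x
      rw [abs_of_nonneg (by positivity), div_le_one (by positivity)]
      refine h1.trans ?_
      nlinarith [sq_nonneg (K : ℝ)]

end FirstLayers

section Network

/-- The hidden layer `i + 1` of the network, for `1 ≤ i`. -/
noncomputable def netLayer (q K i : ℕ) : GadgetLayer :=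
  if i = 1 then firstLayer q K (K + 2 * q - 2)
  else if i = 2 then mulLayer (K + 2 * q - 2) (coord 2 4) 0 fun j => coord (3 + j) 1
  else if i = 3 then
    mulLayer (K + 2 * q - 2) (scaleForm q 2) (scaleBias q 2) fun j => coord (3 + j) 1
  else if i % 2 = 0 then prodLayer (K + 2 * q - (i - 4) / 2 - 2)
  else mulLayer (K + 2 * q - (i - 4) / 2 - 3) (scaleForm q (3 + (i - 4) / 2))
    (scaleBias q (3 + (i - 4) / 2)) (recForm q K (3 + (i - 4) / 2))

/-- The last weight matrix, which selects the outputs of the last hidden layer. -/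
noncomputable def outputWeight (q K j : ℕ) : ℕ → ℝ :=
  if j < K + q + 2 then SplineNet.lift (coord (if j ≤ 1 then j else j + 1) 1) else 0

/-- The network computing `x`, `K` and the B-splines of order `q`. -/
noncomputable def splineNet (q K : ℕ) : ReQUNet where
  L := 4 + 2 * (q - 2)
  arch := archSpec q K
  W i j k := if i = 0 then inputWeight K j else if i = 4 + 2 * (q - 2) then outputWeight q K j k
    else (netLayer q K i).weight j k
  v i j := if i = 1 then inputBias K j else (netLayer q K (i - 1)).bias j

/-- The units of the hidden layer `i + 1`. -/
noncomputable def netUnit (q K : ℕ) (x : ℝ) (i k : ℕ) : ℝ :=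
  requ ((splineNet q K).hidden (fun _ => x) i k - (splineNet q K).v (i + 1) k)

/-- The outputs of the gadgets in the hidden layer `i + 1`. -/
noncomputable def netOutput (q K : ℕ) (x : ℝ) (i g : ℕ) : ℝ :=
  (netUnit q K x i (2 * g) - netUnit q K x i (2 * g + 1)) / 4

variable {q K : ℕ} {x : ℝ}

lemma netUnit_zero : netUnit q K x 0 = inputUnit K x := by
  funext k
  simp [netUnit, inputUnit, splineNet, ReQUNet.hidden, archSpec]

lemma netOutput_succ {i : ℕ} (hi : i + 1 < 4 + 2 * (q - 2)) :
    netOutput q K x (i + 1) =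
      (netLayer q K (i + 1)).output (archSpec q K (i + 1)) (netUnit q K x i) := by
  have key (k : ℕ) : netUnit q K x (i + 1) k =
      requ (lin (archSpec q K (i + 1)) ((netLayer q K (i + 1)).weight k) (netUnit q K x i)
        - (netLayer q K (i + 1)).bias k) := by
    rw [netUnit, ReQUNet.hidden]
    simp only [splineNet, Nat.add_eq_zero_iff, one_ne_zero, and_false, if_false, if_neg hi.ne,
      if_neg (show ¬ i + 1 + 1 = 1 by omega), Nat.add_sub_cancel]
    rfl
  funext g
  rw [netOutput, key, key]
  rfl

lemma eval_splineNet {r G : ℕ} (hr : r < K + q + 2) (hG : K + q + 3 ≤ G)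
    (ha : archSpec q K (4 + 2 * (q - 2)) = 2 * G) :
    (splineNet q K).eval (fun _ => x) r =
      netOutput q K x (3 + 2 * (q - 2)) (if r ≤ 1 then r else r + 1) := by
  have h : (splineNet q K).eval (fun _ => x) r =
      lin (archSpec q K (4 + 2 * (q - 2))) (outputWeight q K r)
        (netUnit q K x (3 + 2 * (q - 2))) := by
    have hW : (splineNet q K).W (3 + 2 * (q - 2) + 1) r = outputWeight q K r := by
      funext k
      simp only [splineNet]
      rw [if_neg (by omega), if_pos (by omega)]
    rw [show 4 + 2 * (q - 2) = 3 + 2 * (q - 2) + 1 by ring, ← hW, ReQUNet.eval,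
      show (splineNet q K).L = 3 + 2 * (q - 2) + 1 by simp only [splineNet]; ring, ReQUNet.hidden]
    rfl
  rw [h, ha, outputWeight, if_pos hr, lin_lift, lin_coord (by split_ifs <;> omega), one_mul]
  rfl

lemma archSpec_quad {i : ℕ} (h2 : 2 ≤ i) (h4 : i ≤ 4) :
    archSpec q K i = 2 * (2 * (K + 2 * q)) := by
  unfold archSpec
  rw [if_neg (by omega), if_neg (by omega), if_pos h4]; ring

lemma archSpec_prod {t : ℕ} (ht : t < q - 2) :
    archSpec q K (5 + 2 * t) = 2 * (6 * (K + 2 * q - t - 3) + 6) := by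
  unfold archSpec
  rw [if_neg (by omega), if_neg (by omega), if_neg (by omega), if_pos (by omega),
    if_pos (by omega)]
  omega

lemma archSpec_mul {t : ℕ} (ht : t < q - 2) :
    archSpec q K (6 + 2 * t) = 2 * (4 * (K + 2 * q - t - 3) + 4) := by
  unfold archSpec
  rw [if_neg (by omega), if_neg (by omega), if_neg (by omega), if_pos (by omega),
    if_neg (by omega)]
  omega

/-- The outputs of the layer computing the B-splines of order `m`. -/
def IsSplineOutput (q K m : ℕ) (x : ℝ) (z : ℕ → ℝ) : Prop :=
  z 0 = x ∧ z 1 = K ∧ z 2 = K * x ∧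
    ∀ j < K + 2 * q - m, z (3 + j) = (if m = q then (K : ℝ) else 1) * (Bspl q K m (j + 1) x / K)

lemma abs_Bspl_div_le (hK : 0 < K) (m j : ℕ) (x : ℝ) : |Bspl q K m j x / K| ≤ 1 := by
  obtain ⟨h0, h1⟩ := Bspl_mem (q := q) hK m j x
  rw [abs_of_nonneg (by positivity), div_le_one (by positivity)]
  exact h1

lemma one_le_scale (hK : 0 < K) (m : ℕ) : 1 ≤ if m = q then (K : ℝ) else 1 := by
  split_ifs
  · exact_mod_cast hK
  · exact le_rfl

lemma isSplineOutput_quad (hq : 2 ≤ q) (hK : 2 ≤ K) (hx0 : 0 ≤ x) (hx1 : x < 1) :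
    IsSplineOutput q K 2 x (netOutput q K x 3) := by
  have hK2 : (2 : ℝ) ≤ K := by exact_mod_cast hK
  have hK0 : 0 < K := by omega
  have hd : archSpec q K 1 = 4 * (K + 2 * q - 1) + K := by simp [archSpec]
  obtain ⟨a0, a1, a2, a3⟩ := firstLayer_output (n := K + 2 * q - 2) (p := archSpec q K 1)
    hK (by omega) hx0 hx1
  have e1 : netOutput q K x 1 = (firstLayer q K (K + 2 * q - 2)).output (archSpec q K 1)
      (inputUnit K x) := by
    rw [netOutput_succ (by omega), netUnit_zero]; rfl
  rw [← e1] at a0 a1 a2 a3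
  have e2 : netOutput q K x 2 = _ := netOutput_succ (by omega)
  rw [archSpec_quad le_rfl (by omega)] at e2
  obtain ⟨b0, b1, -, b3⟩ := mulLayer_output (n := K + 2 * q - 2) (c := coord 2 4) (cb := 0)
    (f := fun j => coord (3 + j) 1) (y := netUnit q K x 1) (z := netOutput q K x 1)
    (b := fun j => Bspl q K 2 (j + 1) x / K ^ 3) (a := (K : ℝ) ^ 2) (G := 2 * (K + 2 * q)) rfl
    (by omega) a0 a1 hx0 hx1.le (by linarith)
    (by rw [lin_coord (by omega), a2]; ring)
    (fun j hj => by rw [lin_coord (by omega), a3 j hj, one_mul])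
    (fun j hj => by
      have h := abs_Bspl_div_le (q := q) hK0 2 (j + 1) x
      rw [show Bspl q K 2 (j + 1) x / (K : ℝ) ^ 3 = Bspl q K 2 (j + 1) x / K / K ^ 2 by
        field_simp, abs_div, abs_of_nonneg (show (0 : ℝ) ≤ K ^ 2 by positivity),
        div_le_iff₀ (by positivity)]
      have h1 : (1 : ℝ) ≤ K ^ 2 := one_le_pow₀ (by linarith)
      nlinarith)
  change netOutput q K x 2 =
    (mulLayer (K + 2 * q - 2) (coord 2 4) 0 fun j => coord (3 + j) 1).output _ _ at e2
  rw [← e2] at b0 b1 b3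
  have e3 : netOutput q K x 3 = _ := netOutput_succ (by omega)
  rw [archSpec_quad (by omega) (by omega)] at e3
  obtain ⟨c0, c1, c2, c3⟩ := mulLayer_output (n := K + 2 * q - 2) (c := scaleForm q 2)
    (cb := scaleBias q 2) (f := fun j => coord (3 + j) 1) (y := netUnit q K x 2)
    (z := netOutput q K x 2) (b := fun j => Bspl q K 2 (j + 1) x / K) (G := 2 * (K + 2 * q)) rfl
    (by omega) b0 b1 hx0 hx1.le (by linarith) (lin_scale (by omega) b1)
    (fun j hj => by
      rw [lin_coord (by omega), b3 j hj]
      field_simp)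
    (fun j _ => (abs_Bspl_div_le hK0 _ _ _).trans (one_le_scale hK0 _))
  rw [IsSplineOutput, e3]
  exact ⟨c0, c1, c2, c3⟩

lemma isSplineOutput_succ {t G : ℕ} (hK : 2 ≤ K) (hx0 : 0 ≤ x) (hx1 : x < 1) (ht : t < q - 2)
    (hG : archSpec q K (4 + 2 * t) = 2 * G) (hG' : 3 + (K + 2 * q - t - 2) ≤ G)
    (h : IsSplineOutput q K (2 + t) x (netOutput q K x (3 + 2 * t))) :
    IsSplineOutput q K (3 + t) x (netOutput q K x (5 + 2 * t)) := by
  have hK2 : (2 : ℝ) ≤ K := by exact_mod_cast hK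
  have hK0 : 0 < K := by omega
  obtain ⟨a0, a1, a2, a3⟩ := h
  rw [if_neg (by omega)] at a3
  have e1 := netOutput_succ (K := K) (x := x) (show 3 + 2 * t + 1 < 4 + 2 * (q - 2) by omega)
  rw [show 3 + 2 * t + 1 = 4 + 2 * t by ring, hG, netLayer, if_neg (by omega), if_neg (by omega),
    if_neg (by omega), if_pos (by omega), show (4 + 2 * t - 4) / 2 = t by omega] at e1
  obtain ⟨b0, b1, b3⟩ := prodLayer_output (n := K + 2 * q - t - 2) (y := netUnit q K x (3 + 2 * t))
    (z := netOutput q K x (3 + 2 * t)) (b := fun j => Bspl q K (2 + t) (j + 1) x / K)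
    rfl hG' a0 a1 a2 hx0 hx1.le (by linarith)
    (fun j hj => by rw [a3 j (by omega), one_mul])
    (fun j _ => abs_Bspl_div_le hK0 _ _ _)
  rw [← e1] at b0 b1 b3
  have e2 := netOutput_succ (K := K) (x := x) (show 4 + 2 * t + 1 < 4 + 2 * (q - 2) by omega)
  rw [show 4 + 2 * t + 1 = 5 + 2 * t by ring, archSpec_prod ht, netLayer, if_neg (by omega),
    if_neg (by omega), if_neg (by omega), if_neg (by omega),
    show (5 + 2 * t - 4) / 2 = t by omega] at e2
  obtain ⟨c0, c1, c2, c3⟩ := mulLayer_output (n := K + 2 * q - t - 3) (c := scaleForm q (3 + t))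
    (cb := scaleBias q (3 + t)) (f := recForm q K (3 + t)) (y := netUnit q K x (4 + 2 * t))
    (z := netOutput q K x (4 + 2 * t)) (b := fun j => Bspl q K (3 + t) (j + 1) x / K)
    (G := 6 * (K + 2 * q - t - 3) + 6) rfl
    (by omega) b0 b1 hx0 hx1.le (by linarith) (lin_scale (by omega) b1)
    (fun j hj => by
      obtain ⟨d0, d1⟩ := b3 j (by omega)
      obtain ⟨d2, d3⟩ := b3 (j + 1) (by omega)
      rw [show 3 + t = 2 + t + 1 by ring]
      refine lin_recForm hK0 (by omega) d0 d1 ?_ ?_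
      · rw [show 4 + 2 * j = 2 + 2 * (j + 1) by ring, d2]
      · rw [show 5 + 2 * j = 3 + 2 * (j + 1) by ring, d3])
    (fun j _ => (abs_Bspl_div_le hK0 _ _ _).trans (one_le_scale hK0 _))
  rw [IsSplineOutput, e2]
  exact ⟨c0, c1, c2, fun j hj => c3 j (by omega)⟩

lemma isSplineOutput_netOutput (hq : 2 ≤ q) (hK : 2 ≤ K) (hx0 : 0 ≤ x) (hx1 : x < 1) {t : ℕ}
    (ht : t ≤ q - 2) : IsSplineOutput q K (2 + t) x (netOutput q K x (3 + 2 * t)) := by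
  induction t with
  | zero => exact isSplineOutput_quad hq hK hx0 hx1
  | succ t ih =>
    rw [show 2 + (t + 1) = 3 + t by ring, show 3 + 2 * (t + 1) = 5 + 2 * t by ring]
    rcases t with _ | t
    · exact isSplineOutput_succ hK hx0 hx1 (by omega) (archSpec_quad (by omega) (by omega))
        (by omega) (ih (by omega))
    · exact isSplineOutput_succ hK hx0 hx1 (by omega)
        (by rw [show 4 + 2 * (t + 1) = 6 + 2 * t by ring]; exact archSpec_mul (by omega))
        (by omega) (ih (by omega))

lemma eval_splineNet_eq (hq : 2 ≤ q) (hK : 2 ≤ K) (hx0 : 0 ≤ x) (hx1 : x < 1) :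
    (splineNet q K).eval (fun _ => x) 0 = x ∧ (splineNet q K).eval (fun _ => x) 1 = K ∧
      ∀ j, 1 ≤ j → j ≤ q + K → (splineNet q K).eval (fun _ => x) (j + 1) = Bspl q K q j x := by
  have hK' : (K : ℝ) ≠ 0 := by positivity
  obtain ⟨h0, h1, -, h3⟩ := isSplineOutput_netOutput (x := x) hq hK hx0 hx1 (le_refl (q - 2))
  rw [show 2 + (q - 2) = q by omega, if_pos rfl] at h3
  obtain ⟨G, hG, ha⟩ : ∃ G, K + q + 3 ≤ G ∧ archSpec q K (4 + 2 * (q - 2)) = 2 * G := by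
    rcases hq.eq_or_lt with h | h
    · exact ⟨2 * (K + 2 * q), by omega, archSpec_quad (by omega) (by omega)⟩
    · refine ⟨_, ?_, by
        rw [show 4 + 2 * (q - 2) = 6 + 2 * (q - 3) by omega]; exact archSpec_mul (by omega)⟩
      omega
  refine ⟨?_, ?_, fun j hj hj' => ?_⟩
  · rw [eval_splineNet (by omega) hG ha, if_pos (by omega), h0]
  · rw [eval_splineNet (by omega) hG ha, if_pos le_rfl, h1]
  · rw [eval_splineNet (by omega) hG ha, if_neg (by omega),
      show j + 1 + 1 = 3 + (j - 1) by omega, h3 _ (by omega), Nat.sub_add_cancel hj]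
    field_simp

end Network

section Size

variable {q K : ℕ}

/-- The number of nonzero weights in the weight matrix `i` of the network. -/
noncomputable def weightCount (q K i : ℕ) : ℕ :=
  ((Finset.range (archSpec q K (i + 1)) ×ˢ Finset.range (archSpec q K i)).filter
    fun z => (splineNet q K).W i z.1 z.2 ≠ 0).card

/-- The number of nonzero biases in the layer `i` of the network. -/
noncomputable def biasCount (q K i : ℕ) : ℕ :=
  ((Finset.range (archSpec q K i)).filter fun j => (splineNet q K).v i j ≠ 0).card

lemma splineNet_weight {i : ℕ} (h0 : 0 < i) (hi : i < 4 + 2 * (q - 2)) (j : ℕ) :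
    (splineNet q K).W i j = (netLayer q K i).weight j := by
  funext k
  simp only [splineNet]
  rw [if_neg h0.ne', if_neg hi.ne]

lemma splineNet_bias {i : ℕ} (h0 : 0 < i) : (splineNet q K).v (i + 1) = (netLayer q K i).bias := by
  funext k
  simp only [splineNet, Nat.add_sub_cancel]
  rw [if_neg (by omega)]

lemma layer_count_le {D : GadgetLayer} {i G c : ℕ} (h0 : 0 < i) (hi : i < 4 + 2 * (q - 2))
    (hD : netLayer q K i = D) (hG : D.UnusedFrom G) (hc : ∀ j, Sparse c (D.weight j)) :
    weightCount q K i + biasCount q K (i + 1) ≤ 2 * G * (c + 1) := by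
  subst hD
  have h1 : weightCount q K i ≤ ∑ j ∈ Finset.range (2 * G), c := card_weights_le
    (fun j hj => by rw [splineNet_weight h0 hi, hG.weight_eq hj])
    (fun j _ => by rw [splineNet_weight h0 hi]; exact hc j)
  have h2 : biasCount q K (i + 1) ≤ 2 * G :=
    card_bias_le fun j hj => by rw [splineNet_bias h0, hG.bias_eq hj]
  rw [Finset.sum_const, Finset.card_range, smul_eq_mul] at h1
  rw [mul_add, mul_one]
  omega

lemma input_count_le (q K : ℕ) : weightCount q K 0 + biasCount q K 1 ≤ 6 * K + 6 := by
  have h1 : weightCount q K 0 ≤ ∑ j ∈ Finset.range (3 * K + 3), 1 := by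
    have : weightCount q K 0 = ((Finset.range (archSpec q K 1) ×ˢ
        Finset.range (archSpec q K 0)).filter
          fun z => coord 0 (inputWeight K z.1) z.2 ≠ 0).card := by
      refine congrArg Finset.card (Finset.filter_congr fun z hz => ?_)
      have hz2 := (Finset.mem_product.1 hz).2
      rw [archSpec, if_pos rfl, Finset.mem_range, Nat.lt_one_iff] at hz2
      simp [splineNet, coord, hz2]
    rw [this]
    refine card_weights_le (W := fun j => coord 0 (inputWeight K j)) (fun j hj => ?_)
      (fun j _ => sparse_coord _ _)
    funext k
    have : inputWeight K j = 0 := by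
      unfold inputWeight
      rw [if_neg (by omega), if_neg (by omega), if_neg (by omega), if_neg (by omega),
        if_neg (by omega)]
    simp [coord, this]
  have h2 : biasCount q K 1 ≤ 3 * K + 3 := card_bias_le fun j hj => by
    simp only [splineNet, if_true, inputBias]
    rw [if_neg (by omega), if_neg (by omega), if_neg (by omega)]
  simp only [Finset.sum_const, Finset.card_range, smul_eq_mul, mul_one] at h1
  omega

lemma output_count_le (q K : ℕ) : weightCount q K (4 + 2 * (q - 2)) ≤ 2 * (K + q + 2) := by
  have hW (j : ℕ) : (splineNet q K).W (4 + 2 * (q - 2)) j = outputWeight q K j := by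
    funext k
    simp only [splineNet]
    rw [if_neg (by omega), if_pos trivial]
  have h : weightCount q K (4 + 2 * (q - 2)) ≤ ∑ j ∈ Finset.range (K + q + 2), 2 :=
    card_weights_le (fun j hj => by rw [hW, outputWeight, if_neg (by omega)])
      (fun j hj => by rw [hW, outputWeight, if_pos hj]; exact (sparse_coord _ _).lift)
  rw [Finset.sum_const, Finset.card_range, smul_eq_mul] at h
  omega

lemma first_count_le (hq : 2 ≤ q) :
    weightCount q K 1 + biasCount q K 2 ≤ 10 * (K + 2 * q + 1) + 8 * K := by
  have hG : (netLayer q K 1).UnusedFrom (K + 2 * q + 1) := by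
    have := firstLayer_unusedFrom q K (K + 2 * q - 2)
    rwa [show K + 2 * q - 2 + 3 = K + 2 * q + 1 by omega] at this
  have h1 : weightCount q K 1 ≤ ∑ j ∈ Finset.range (2 * (K + 2 * q + 1)),
      if j / 2 = 1 ∨ j / 2 = 2 then 2 * K else 4 := card_weights_le
    (fun j hj => by rw [splineNet_weight one_pos (by omega), hG.weight_eq hj])
    (fun j _ => by rw [splineNet_weight one_pos (by omega)]; exact firstLayer_sparse _ j)
  have h2 : biasCount q K 2 ≤ 2 * (K + 2 * q + 1) :=
    card_bias_le fun j hj => by rw [splineNet_bias one_pos, hG.bias_eq hj]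
  have h3 : ∑ j ∈ Finset.range (2 * (K + 2 * q + 1)),
      (if j / 2 = 1 ∨ j / 2 = 2 then 2 * K else 4) ≤
      ∑ j ∈ Finset.range (2 * (K + 2 * q + 1)), (4 + if j ∈ Finset.Ico 2 6 then 2 * K else 0) := by
    refine Finset.sum_le_sum fun j _ => ?_
    split_ifs with h h'
    · omega
    · rw [Finset.mem_Ico] at h'; omega
    · omega
    · omega
  have h4 : ∑ j ∈ Finset.range (2 * (K + 2 * q + 1)), (if j ∈ Finset.Ico 2 6 then 2 * K else 0) ≤
      8 * K := by
    rw [← Finset.sum_filter, Finset.filter_mem_eq_inter, Finset.sum_const, smul_eq_mul]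
    have : (Finset.range (2 * (K + 2 * q + 1)) ∩ Finset.Ico 2 6).card ≤ 4 :=
      Finset.card_le_card Finset.inter_subset_right
    nlinarith
  rw [Finset.sum_add_distrib, Finset.sum_const, Finset.card_range, smul_eq_mul] at h3
  omega

lemma sum_range_add_two_mul_le {C : ℕ → ℕ} {a b s : ℕ} (h0 : C 0 + C 1 + C 2 + C 3 ≤ a)
    (h : ∀ t < s, C (4 + 2 * t) + C (5 + 2 * t) ≤ b) :
    ∑ i ∈ Finset.range (4 + 2 * s), C i ≤ a + s * b := by
  induction s with
  | zero => simpa [Finset.sum_range_succ] using h0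
  | succ s ih =>
    rw [show 4 + 2 * (s + 1) = 4 + 2 * s + 1 + 1 by ring, Finset.sum_range_succ,
      Finset.sum_range_succ, add_mul, one_mul, show 4 + 2 * s + 1 = 5 + 2 * s by ring]
    have h1 := ih fun t ht => h t (by omega)
    have h2 := h s (by omega)
    omega

lemma numNonzero_splineNet_le (hq : 2 ≤ q) (hK : 2 ≤ K) :
    (splineNet q K).numNonzero ≤ 72 * q * (K + 2 * q) := by
  have e : (splineNet q K).numNonzero = ∑ i ∈ Finset.range (4 + 2 * (q - 2)),
      (weightCount q K i + biasCount q K (i + 1)) + weightCount q K (4 + 2 * (q - 2)) := by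
    have : (splineNet q K).numNonzero = ∑ i ∈ Finset.range (4 + 2 * (q - 2) + 1), weightCount q K i
        + ∑ i ∈ Finset.Icc 1 (4 + 2 * (q - 2)), biasCount q K i := rfl
    rw [this, Finset.sum_range_succ, Finset.sum_add_distrib, Finset.range_eq_Ico,
      Finset.sum_Ico_add' (biasCount q K), ← Finset.Ico_succ_right_eq_Icc]
    simp only [zero_add, Order.succ_eq_add_one]
    ring
  have h0 := input_count_le q K
  have h1 := first_count_le (K := K) hq
  have h2 : weightCount q K 2 + biasCount q K 3 ≤ 2 * (K + 2 * q - 2 + 3) * (4 + 1) :=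
    layer_count_le (D := mulLayer (K + 2 * q - 2) (coord 2 4) 0 fun j => coord (3 + j) 1)
      two_pos (by omega) rfl (mulLayer_unusedFrom _ _ _ _)
      (mulLayer_sparse le_rfl le_rfl (sparse_coord _ _) fun _ => sparse_coord _ _)
  have h3 : weightCount q K 3 + biasCount q K 4 ≤ 2 * (K + 2 * q - 2 + 3) * (4 + 1) :=
    layer_count_le
      (D := mulLayer (K + 2 * q - 2) (scaleForm q 2) (scaleBias q 2) fun j => coord (3 + j) 1)
      three_pos (by omega) rfl (mulLayer_unusedFrom _ _ _ _)
      (mulLayer_sparse le_rfl le_rfl (scaleForm_sparse _ _) fun _ => sparse_coord _ _)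
  have h4 : ∀ t < q - 2, weightCount q K (4 + 2 * t) + biasCount q K (4 + 2 * t + 1)
      + (weightCount q K (5 + 2 * t) + biasCount q K (5 + 2 * t + 1)) ≤ 72 * (K + 2 * q) := by
    intro t ht
    have e1 : netLayer q K (4 + 2 * t) = prodLayer (K + 2 * q - t - 2) := by
      rw [netLayer, if_neg (by omega), if_neg (by omega), if_neg (by omega), if_pos (by omega),
        show (4 + 2 * t - 4) / 2 = t by omega]
    have e2 : netLayer q K (5 + 2 * t) = mulLayer (K + 2 * q - t - 3) (scaleForm q (3 + t))
        (scaleBias q (3 + t)) (recForm q K (3 + t)) := by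
      rw [netLayer, if_neg (by omega), if_neg (by omega), if_neg (by omega), if_neg (by omega),
        show (5 + 2 * t - 4) / 2 = t by omega]
    have k1 : weightCount q K (4 + 2 * t) + biasCount q K (4 + 2 * t + 1) ≤ _ :=
      layer_count_le (by omega) (by omega) e1 (prodLayer_unusedFrom _)
        (prodLayer_sparse _)
    have k2 : weightCount q K (5 + 2 * t) + biasCount q K (5 + 2 * t + 1) ≤ _ :=
      layer_count_le (by omega) (by omega) e2 (mulLayer_unusedFrom _ _ _ _)
        (mulLayer_sparse le_rfl (by norm_num) (scaleForm_sparse _ _)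
          (recForm_sparse q K (3 + t)))
    omega
  have h5 := output_count_le q K
  have h6 := sum_range_add_two_mul_le (C := fun i => weightCount q K i + biasCount q K (i + 1))
    (a := 30 * (K + 2 * q) + 14 * K + 36) (by simp only [zero_add, Nat.reduceAdd]; omega) h4
  obtain ⟨s, rfl⟩ : ∃ s, q = s + 2 := ⟨q - 2, by omega⟩
  rw [e]
  simp only [Nat.add_sub_cancel] at h5 h6 ⊢
  have : 72 * (s + 2) * (K + 2 * (s + 2)) =
      s * (72 * (K + 2 * (s + 2))) + 144 * (K + 2 * (s + 2)) := by ring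
  rw [this]
  omega

lemma netLayer_bounded (hK : 2 ≤ K) (i : ℕ) : (netLayer q K i).Bounded := by
  have h1 (j k : ℕ) := abs_coord_le (3 + j) 1 k
  simp only [abs_one] at h1
  unfold netLayer
  split_ifs
  · exact firstLayer_bounded hK _
  · refine mulLayer_bounded (fun j k => ?_) (by simp)
    by_cases hk : k = 2
    · rw [show coord (3 + j) 1 k = 0 from if_neg (by omega), abs_zero, add_zero]
      refine (abs_coord_le _ _ _).trans (by norm_num)
    · rw [show coord 2 4 k = 0 from if_neg hk, abs_zero, zero_add]
      exact (h1 j k).trans (by norm_num)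
  · exact mulLayer_bounded (fun j k => by linarith [abs_scaleForm_le q 2 k, h1 j k])
      (abs_scaleBias_le _ _)
  · exact prodLayer_bounded _
  · exact mulLayer_bounded (fun j k => by
      linarith [abs_scaleForm_le q (3 + (i - 4) / 2) k,
        abs_recForm_le (q := q) (show 0 < K by omega) (3 + (i - 4) / 2) j k])
      (abs_scaleBias_le _ _)

lemma weightsIn_splineNet (hK : 2 ≤ K) : (splineNet q K).weightsIn (Set.Icc (-1) 1) := by
  refine ⟨fun i _ j _ k _ => ?_, fun i _ _ j _ => ?_⟩ <;> rw [Set.mem_Icc, ← abs_le]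
  · simp only [splineNet]
    split_ifs
    · exact abs_inputWeight_le _ _
    · unfold outputWeight SplineNet.lift
      have h (a : ℕ) : |coord a 1 (k / 2) / 4| ≤ 1 := by
        rw [abs_div, abs_of_pos (show (0 : ℝ) < 4 by norm_num), div_le_one (by norm_num)]
        refine (abs_coord_le _ _ _).trans (by norm_num)
      split_ifs with h1 h2
      · dsimp only
        split_ifs
        · exact h _
        · rw [abs_neg]; exact h _
      · dsimp only
        split_ifs
        · exact h _
        · rw [abs_neg]; exact h _
      · simp
    · exact (netLayer_bounded hK i).1 j k
  · simp only [splineNet]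
    split_ifs
    · exact abs_inputBias_le (by omega) _
    · exact (netLayer_bounded hK _).2 j

end Size

end SplineNet

theorem statement7 (q K : ℕ) (hq : 2 ≤ q) (hK : 2 ≤ K) :
    ∃ N : ReQUNet,
      N.L = 4 + 2 * (q - 2) ∧
      (∀ i ≤ N.L + 1, N.arch i = archSpec q K i) ∧
      N.weightsIn (Set.Icc (-1) 1) ∧
      N.numNonzero ≤ 72 * q * (K + 2 * q) ∧
      ∀ x : ℝ, 0 ≤ x → x < 1 →
        N.eval (fun _ => x) 0 = x ∧
        N.eval (fun _ => x) 1 = (K : ℝ) ∧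
        ∀ j : ℕ, 1 ≤ j → j ≤ q + K →
          N.eval (fun _ => x) (j + 1) = Bspl q K q j x := by
  exact ⟨SplineNet.splineNet q K, rfl, fun _ _ => rfl, SplineNet.weightsIn_splineNet hK,
    SplineNet.numNonzero_splineNet_le hq hK,
    fun _ hx0 hx1 => SplineNet.eval_splineNet_eq hq hK hx0 hx1⟩
end

section
/- Let L be a positive integer and let M be a real number with |M| ≤ 4^(4^L). Then there exists a ReQU network of architecture (1, 5, 5, …, 5, 4, 1), consisting of 2L+1 hidden layers of width 5 followed by one hidden layer of width 4 (so 2L+2 hidden layers in total), with all weights in [−1,1] and at most 60L + 38 nonzero weights, which computes the map x ↦ M·x for every x ∈ ℝ. -/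
open scoped BigOperators Classical

theorem requ_add_requ_neg (y : ℝ) : requ y + requ (-y) = y ^ 2 := by
  unfold requ
  rcases le_total 0 y with h | h
  · rw [max_eq_left h, max_eq_right (by linarith)]; ring
  · rw [max_eq_right h, max_eq_left (by linarith)]; ring

theorem requ_of_nonneg {y : ℝ} (h : 0 ≤ y) : requ y = y ^ 2 := by
  rw [requ, max_eq_left h]

namespace ReQUNet

/-- The sign with which the linear part enters the `j`-th unit of a multiplication layer. -/
def linSign : ℕ → ℝ
  | 0 => 1
  | 1 => -1
  | 2 => 1
  | 3 => -1
  | _ => 0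

/-- The sign with which the constant enters the `j`-th unit of a multiplication layer. -/
def constSign : ℕ → ℝ
  | 0 => 1
  | 1 => -1
  | 2 => -1
  | 3 => 1
  | _ => 1

/-- Output coefficients of a multiplication layer. -/
def prodCoeff : ℕ → ℝ
  | 0 => 1
  | 1 => 1
  | 2 => -1
  | 3 => -1
  | _ => 0

theorem sum_prodCoeff_mul_requ (a c : ℝ) :
    ∑ k ∈ Finset.range 4, prodCoeff k * requ (linSign k * a + constSign k * c) = 4 * (a * c) := by
  have h₁ := requ_add_requ_neg (a + c)
  have h₂ := requ_add_requ_neg (a - c)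
  simp only [Finset.sum_range_succ, Finset.sum_range_zero, prodCoeff, linSign, constSign]
  rw [show (1 : ℝ) * a + 1 * c = a + c by ring, show (-1 : ℝ) * a + -1 * c = -(a + c) by ring,
    show (1 : ℝ) * a + -1 * c = a - c by ring, show (-1 : ℝ) * a + 1 * c = -(a - c) by ring]
  linarith

/-- The weight feeding the `k`-th unit of a multiplication layer to the `j`-th unit of the next. -/
noncomputable def mulWeight (j k : ℕ) : ℝ :=
  linSign j * prodCoeff k + constSign j * if k = 4 then 1 else 0

theorem sum_mulWeight_mul_requ (j : ℕ) (a : ℝ) {c : ℝ} (hc : 0 ≤ c) :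
    ∑ k ∈ Finset.range 5, mulWeight j k * requ (linSign k * a + constSign k * c) =
      linSign j * (4 * (a * c)) + constSign j * c ^ 2 := by
  rw [← sum_prodCoeff_mul_requ, ← requ_of_nonneg hc]
  simp [Finset.sum_range_succ, mulWeight, prodCoeff, linSign, constSign]
  ring

/-- Multiplication layers carrying a multiple of the input and a repeatedly squared constant,
with output coefficients scaled by `r`. -/
noncomputable def scaling (L : ℕ) (r : ℝ) : ReQUNet where
  L := 2 * L + 2
  arch i := if i = 0 then 1 else if i ≤ 2 * L + 1 then 5 else if i = 2 * L + 2 then 4 else 1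
  W i j k := if i = 0 then linSign j else if i ≤ 2 * L + 1 then mulWeight j k else r * prodCoeff k
  v i j := if i ≤ 2 then -constSign j else 0

theorem scaling_weightsIn (L : ℕ) {r : ℝ} (hr : |r| ≤ 1) :
    (scaling L r).weightsIn (Set.Icc (-1) 1) := by
  obtain ⟨hr₁, hr₂⟩ := abs_le.mp hr
  have lin (j : ℕ) : linSign j ∈ Set.Icc (-1 : ℝ) 1 := by
    unfold linSign; split <;> norm_num
  have const (j : ℕ) : -constSign j ∈ Set.Icc (-1 : ℝ) 1 := by
    unfold constSign; split <;> norm_num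
  have mul (j k : ℕ) : mulWeight j k ∈ Set.Icc (-1 : ℝ) 1 := by
    unfold mulWeight linSign prodCoeff constSign
    split <;> split <;> norm_num <;> split <;> norm_num
  have out (k : ℕ) : r * prodCoeff k ∈ Set.Icc (-1 : ℝ) 1 := by
    unfold prodCoeff; split <;> constructor <;> linarith
  constructor
  · intro i _ j _ k _
    dsimp only [scaling]
    split_ifs
    exacts [lin j, mul j k, out k]
  · intro i _ _ j _
    dsimp only [scaling]
    split_ifs
    exacts [const j, by norm_num]

theorem numNonzero_le (N : ReQUNet) :
    N.numNonzero ≤ ∑ i ∈ Finset.range (N.L + 1), N.arch (i + 1) * N.arch i +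
      ∑ i ∈ Finset.range N.L, N.arch (i + 1) := by
  unfold numNonzero
  gcongr with i
  · exact (Finset.card_filter_le _ _).trans (by simp)
  · rw [Finset.range_eq_Ico, Finset.sum_Ico_add' N.arch, zero_add]
    exact Finset.sum_le_sum fun i _ => (Finset.card_filter_le _ _).trans (by simp)

theorem scaling_numNonzero_le (L : ℕ) (r : ℝ) : (scaling L r).numNonzero ≤ 60 * L + 38 := by
  have arch_mid {i : ℕ} (hi : i < 2 * L + 1) : (scaling L r).arch (i + 1) = 5 := by
    simp [scaling, Nat.succ_le_of_lt hi]
  have arch_zero : (scaling L r).arch 0 = 1 := rfl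
  have arch_pen : (scaling L r).arch (2 * L + 1 + 1) = 4 := by simp [scaling]
  have arch_out : (scaling L r).arch (2 * L + 1 + 1 + 1) = 1 := by simp [scaling]
  have weights : ∑ i ∈ Finset.range (2 * L),
      (scaling L r).arch (i + 1 + 1) * (scaling L r).arch (i + 1) = 2 * L * 25 := by
    rw [Finset.sum_congr rfl (g := fun _ => 25)]
    · simp
    · intro i hi
      have := Finset.mem_range.mp hi
      rw [arch_mid (by omega), arch_mid (by omega)]
  have biases : ∑ i ∈ Finset.range (2 * L + 1), (scaling L r).arch (i + 1) = (2 * L + 1) * 5 := by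
    rw [Finset.sum_congr rfl fun i hi => arch_mid (Finset.mem_range.mp hi)]
    simp
  have h := numNonzero_le (scaling L r)
  rw [show (scaling L r).L = 2 * L + 1 + 1 from rfl, Finset.sum_range_succ, Finset.sum_range_succ,
    Finset.sum_range_succ', weights, Finset.sum_range_succ, biases, arch_out, arch_pen,
    arch_mid (i := 2 * L) (by omega), arch_mid (i := 0) (by omega), arch_zero] at h
  omega

theorem scaling_hidden_succ (L : ℕ) (r x : ℝ) {n : ℕ} (hn : n ≤ 2 * L) {a c : ℝ} (hc : 0 ≤ c)
    (h : ∀ k, (scaling L r).hidden (fun _ => x) n k - (scaling L r).v (n + 1) k =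
      linSign k * a + constSign k * c) (j : ℕ) :
    (scaling L r).hidden (fun _ => x) (n + 1) j =
      linSign j * (4 * (a * c)) + constSign j * c ^ 2 := by
  rw [← sum_mulWeight_mul_requ j a hc, hidden]
  simp only [h]
  simp [scaling, hn]

theorem scaling_hidden (L : ℕ) (r x : ℝ) (n : ℕ) (hn : n ≤ 2 * L) (j : ℕ) :
    (scaling L r).hidden (fun _ => x) (n + 1) j - (scaling L r).v (n + 2) j =
      linSign j * (4 ^ n * 2 * 2 ^ 2 ^ n * x) + constSign j * 2 ^ 2 ^ n := by
  induction n generalizing j with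
  | zero =>
    rw [scaling_hidden_succ L r x hn zero_le_one (a := x)]
    · simp [scaling]; ring
    · intro k; simp [scaling, hidden]
  | succ n ih =>
    rw [scaling_hidden_succ L r x hn (by positivity) (ih (by omega))]
    simp [scaling]; ring

theorem scaling_eval (L : ℕ) (r x : ℝ) :
    (scaling L r).eval (fun _ => x) 0 = r * (8 * 4 ^ (2 * L) * 4 ^ 4 ^ L) * x := by
  have h := scaling_hidden L r x (2 * L) le_rfl
  rw [eval, show (scaling L r).L = 2 * L + 1 + 1 from rfl, hidden]
  simp only [h]
  have w (k : ℕ) : (scaling L r).W (2 * L + 1 + 1) 0 k = r * prodCoeff k := by simp [scaling]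
  have arch_pen : (scaling L r).arch (2 * L + 1 + 1) = 4 := by simp [scaling]
  simp only [w, arch_pen, mul_assoc r, ← Finset.mul_sum]
  have h_sq : (4 : ℝ) ^ 4 ^ L = (2 ^ 2 ^ (2 * L)) ^ 2 := by
    rw [← pow_mul, mul_comm, pow_mul, pow_mul 2 2 L]
    norm_num
  rw [sum_prodCoeff_mul_requ, h_sq]
  ring

end ReQUNet

theorem statement8 (L : ℕ) (hL : 0 < L) (M : ℝ) (hM : |M| ≤ (4 : ℝ) ^ (4 ^ L)) :
    ∃ N : ReQUNet,
      N.L = 2 * L + 2 ∧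
      N.arch 0 = 1 ∧
      (∀ i : ℕ, 1 ≤ i → i ≤ 2 * L + 1 → N.arch i = 5) ∧
      N.arch (2 * L + 2) = 4 ∧ N.arch (2 * L + 3) = 1 ∧
      N.weightsIn (Set.Icc (-1) 1) ∧
      N.numNonzero ≤ 60 * L + 38 ∧
      ∀ x : ℝ, N.eval (fun _ => x) 0 = M * x := by
  have hK : 1 ≤ (8 : ℝ) * 4 ^ (2 * L) := by
    have := one_le_pow₀ (show (1 : ℝ) ≤ 4 by norm_num) (n := 2 * L)
    linarith
  have hP : (0 : ℝ) < 8 * 4 ^ (2 * L) * 4 ^ 4 ^ L := by positivity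
  refine ⟨ReQUNet.scaling L (M / (8 * 4 ^ (2 * L) * 4 ^ 4 ^ L)), rfl, rfl, ?_, ?_, ?_,
    ReQUNet.scaling_weightsIn L ?_, ReQUNet.scaling_numNonzero_le L _, fun x => ?_⟩
  · intro i hi hi'
    simp [ReQUNet.scaling, hi', Nat.ne_of_gt hi]
  · simp [ReQUNet.scaling]
  · simp [ReQUNet.scaling]
  · rw [abs_div, abs_of_pos hP, div_le_one hP]
    exact hM.trans (le_mul_of_one_le_left (by positivity) hK)
  · rw [ReQUNet.scaling_eval, div_mul_cancel₀ _ hP.ne']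
end
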